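/- arXiv:1803.03143 — 6 statements merged into one kernel-verified Lean document; each statement's English description precedes it below -/
import Mathlib

section
/- Let β, γ > −1 with β + γ + 1 ≠ 0, let L > 0, let 1 < α < 2, and let j be a nonnegative integer. Then for every x ∈ (0, L), the left-side Riemann–Liouville fractional derivative of the shifted Jacobi polynomial satisfies ₀D_x^α J_{L,j}^{β,γ}(x) = Σ_{k=0}^{j} Σ_{i=0}^{k} Θ_{i,j,k}^{α,β,γ} · Υ_{i,k}^{β,γ} · x^{−α} · J_{L,i}^{β,γ}(x), where Θ_{i,j,k}^{α,β,γ} = (−1)^{i+j+k} Γ(1+β+γ+j+k) Γ(1+γ+j) Γ(1+k) / [Γ(1+β+γ+j) Γ(1+γ+k) Γ(1+k−α) (j−k)! k!] and Υ_{i,k}^{β,γ} = (−k)_i (1+γ)_k (2+β+γ)_{i−1} (1+β+γ+2i) / [(1+γ)_i (2+β+γ)_k (2+k+β+γ)_i]. -/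
open Real Finset MeasureTheory

/-- Pochhammer's symbol `(a)_n = Γ(a+n)/Γ(a)` for real `a` and integer `n`
(in particular `(a)_{-1} = 1/(a-1)`). -/
noncomputable def poch (a : ℝ) (n : ℤ) : ℝ := Real.Gamma (a + n) / Real.Gamma a

/-- The shifted Jacobi polynomial `J_{L,k}^{β,γ}` on `[0,L]`. -/
noncomputable def shiftedJacobi (L β γ : ℝ) (k : ℕ) (x : ℝ) : ℝ :=
  ∑ i ∈ Finset.range (k + 1),
    (-1 : ℝ) ^ (k - i) * Real.Gamma ((k : ℝ) + γ + 1) * Real.Gamma ((k : ℝ) + (i : ℝ) + β + γ + 1) /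
      (Real.Gamma ((i : ℝ) + γ + 1) * Real.Gamma ((k : ℝ) + β + γ + 1) *
        (Nat.factorial (k - i) : ℝ) * (Nat.factorial i : ℝ) * L ^ i) * x ^ i

/-- The coefficient `Θ_{i,j,k}^{α,β,γ}`. -/
noncomputable def Theta (α β γ : ℝ) (i j k : ℕ) : ℝ :=
  (-1 : ℝ) ^ (i + j + k) * Real.Gamma (1 + β + γ + (j : ℝ) + (k : ℝ)) *
      Real.Gamma (1 + γ + (j : ℝ)) * Real.Gamma (1 + (k : ℝ)) /
    (Real.Gamma (1 + β + γ + (j : ℝ)) * Real.Gamma (1 + γ + (k : ℝ)) *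
      Real.Gamma (1 + (k : ℝ) - α) * (Nat.factorial (j - k) : ℝ) * (Nat.factorial k : ℝ))

/-- The coefficient `Υ_{i,k}^{β,γ}`, with `(-k)_i = (-1)^i k!/(k-i)!`. -/
noncomputable def Upsilon (β γ : ℝ) (i k : ℕ) : ℝ :=
  ((-1 : ℝ) ^ i * (Nat.factorial k : ℝ) / (Nat.factorial (k - i) : ℝ)) * poch (1 + γ) k *
      poch (2 + β + γ) ((i : ℤ) - 1) * (1 + β + γ + 2 * (i : ℝ)) /
    (poch (1 + γ) i * poch (2 + β + γ) k * poch (2 + (k : ℝ) + β + γ) i)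

/-- Euler's beta integral on `[0, y]` with an integer exponent. -/
lemma integral_sub_rpow_mul_pow {a y : ℝ} (ha : -1 < a) (hy : 0 < y) (k : ℕ) :
    ∫ ξ in (0:ℝ)..y, (y - ξ) ^ a * ξ ^ k =
      Real.Gamma (a + 1) * (k.factorial : ℝ) / Real.Gamma (k + a + 2) * y ^ (k + a + 1) := by
  have h := Complex.betaIntegral_scaled ((k : ℂ) + 1) ((a : ℂ) + 1) hy
  rw [Complex.betaIntegral_eq_Gamma_mul_div _ _ (by simp; positivity) (by simp; linarith)] at h
  have hl : ∫ ξ in (0:ℝ)..y, (ξ : ℂ) ^ ((k : ℂ) + 1 - 1) * ((y : ℂ) - ξ) ^ ((a : ℂ) + 1 - 1) =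
      ((∫ ξ in (0:ℝ)..y, (y - ξ) ^ a * ξ ^ k : ℝ) : ℂ) := by
    rw [← intervalIntegral.integral_ofReal]
    refine intervalIntegral.integral_congr fun ξ hξ => ?_
    rw [Set.uIcc_of_le hy.le] at hξ
    simp only [add_sub_cancel_right, Complex.cpow_natCast]
    rw [← Complex.ofReal_sub, ← Complex.ofReal_cpow (sub_nonneg.2 hξ.2)]
    push_cast
    ring
  have hr : (y : ℂ) ^ ((k : ℂ) + 1 + ((a : ℂ) + 1) - 1) *
      (Complex.Gamma ((k : ℂ) + 1) * Complex.Gamma ((a : ℂ) + 1) /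
        Complex.Gamma ((k : ℂ) + 1 + ((a : ℂ) + 1))) =
      ((Real.Gamma (a + 1) * (k.factorial : ℝ) / Real.Gamma (k + a + 2) *
        y ^ (k + a + 1) : ℝ) : ℂ) := by
    rw [Complex.Gamma_nat_eq_factorial,
      show (k : ℂ) + 1 + ((a : ℂ) + 1) - 1 = ((k + a + 1 : ℝ) : ℂ) by push_cast; ring,
      show (k : ℂ) + 1 + ((a : ℂ) + 1) = ((k + a + 2 : ℝ) : ℂ) by push_cast; ring,
      show (a : ℂ) + 1 = ((a + 1 : ℝ) : ℂ) by push_cast; ring,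
      ← Complex.ofReal_cpow hy.le, Complex.Gamma_ofReal, Complex.Gamma_ofReal]
    push_cast
    ring
  rw [hl, hr] at h
  exact_mod_cast h

lemma intervalIntegrable_sub_rpow_mul_pow {a : ℝ} (ha : -1 < a) (y : ℝ) (k : ℕ) :
    IntervalIntegrable (fun ξ : ℝ => (y - ξ) ^ a * ξ ^ k) volume 0 y := by
  refine IntervalIntegrable.mul_continuousOn ?_ (by fun_prop)
  simpa using
    ((intervalIntegral.intervalIntegrable_rpow' (a := 0) (b := y) ha).comp_sub_left y).symm

lemma iteratedDeriv_two_rpow_const {x : ℝ} (hx : 0 < x) (r : ℝ) :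
    iteratedDeriv 2 (fun y : ℝ => y ^ r) x = r * (r - 1) * x ^ (r - 2) := by
  rw [iteratedDeriv_eq_iterate, Real.iter_deriv_rpow_const]
  simp [descPochhammer_succ_right]

/-- The Riemann–Liouville derivative of order `1 < α < 2` of a polynomial. -/
lemma iteratedDeriv_two_integral_rpow_mul_sum {α x : ℝ} (hα1 : 1 < α) (hα2 : α < 2) (hx : 0 < x)
    (s : Finset ℕ) (c : ℕ → ℝ) :
    iteratedDeriv 2 (fun y : ℝ => (1 / Real.Gamma (2 - α)) *
        ∫ ξ in (0:ℝ)..y, (y - ξ) ^ (1 - α) * ∑ k ∈ s, c k * ξ ^ k) x =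
      ∑ k ∈ s, c k * ((k.factorial : ℝ) / Real.Gamma (1 + k - α)) * x ^ ((k : ℝ) - α) := by
  have hΓ : Real.Gamma (2 - α) ≠ 0 := (Real.Gamma_pos_of_pos (by linarith)).ne'
  have hev : (fun y : ℝ => (1 / Real.Gamma (2 - α)) *
        ∫ ξ in (0:ℝ)..y, (y - ξ) ^ (1 - α) * ∑ k ∈ s, c k * ξ ^ k) =ᶠ[nhds x]
      fun y => ∑ k ∈ s, c k * ((k.factorial : ℝ) / Real.Gamma (k + 3 - α)) *
        y ^ ((k : ℝ) + 2 - α) := by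
    filter_upwards [lt_mem_nhds hx] with y hy
    have hint : ∀ k : ℕ, IntervalIntegrable (fun ξ : ℝ => c k * ((y - ξ) ^ (1 - α) * ξ ^ k))
        volume 0 y := fun k =>
      (intervalIntegrable_sub_rpow_mul_pow (by linarith) y k).const_mul _
    have hsum : ∀ ξ : ℝ, (y - ξ) ^ (1 - α) * ∑ k ∈ s, c k * ξ ^ k =
        ∑ k ∈ s, c k * ((y - ξ) ^ (1 - α) * ξ ^ k) := fun ξ => by
      rw [Finset.mul_sum]
      exact Finset.sum_congr rfl fun k _ => by ring
    simp_rw [hsum]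
    rw [intervalIntegral.integral_finsetSum fun k _ => hint k, Finset.mul_sum]
    refine Finset.sum_congr rfl fun k _ => ?_
    rw [intervalIntegral.integral_const_mul, integral_sub_rpow_mul_pow (by linarith) hy,
      show 1 - α + 1 = 2 - α by ring, show (k : ℝ) + (1 - α) + 2 = k + 3 - α by ring,
      show (k : ℝ) + (1 - α) + 1 = k + 2 - α by ring]
    field_simp
  rw [hev.iteratedDeriv_eq, iteratedDeriv_fun_sum fun k _ =>
    contDiffAt_const.mul (Real.contDiffAt_rpow_const_of_ne hx.ne')]
  refine Finset.sum_congr rfl fun k _ => ?_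
  rw [iteratedDeriv_const_mul_field, iteratedDeriv_two_rpow_const hx]
  have h1 : (1 : ℝ) + k - α ≠ 0 := by
    rcases k with _ | k
    · simp; linarith
    · push_cast
      have : (0 : ℝ) ≤ k := k.cast_nonneg
      linarith
  have h2 : (2 : ℝ) + k - α ≠ 0 := by
    have : (0 : ℝ) ≤ k := k.cast_nonneg
    linarith
  rw [show (k : ℝ) + 3 - α = (1 + k - α + 1) + 1 by ring,
    Real.Gamma_add_one (by convert h2 using 1; ring),
    Real.Gamma_add_one h1, show (k : ℝ) + 2 - α - 2 = k - α by ring,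
    show (k : ℝ) + 2 - α = 2 + k - α by ring, show (1 : ℝ) + k - α + 1 = 2 + k - α by ring,
    show (2 : ℝ) + k - α - 1 = 1 + k - α by ring]
  by_cases hG : Real.Gamma (1 + k - α) = 0
  · simp [hG]
  · field_simp

/-- Partial sums of the orthogonality sum, which telescopes. -/
lemma sum_range_alternating_Gamma {t : ℝ} (ht : -1 < t) (ht0 : t ≠ 0) {n p : ℕ} (hn : 0 < n)
    (hp : p ≤ n) :
    ∑ l ∈ range p, (-1 : ℝ) ^ l * (t + 2 * l) * Real.Gamma (t + l) /
        (l.factorial * (n - l).factorial * Real.Gamma (t + 1 + n + l)) =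
      (-1) ^ (p + 1) * p * Real.Gamma (t + p) /
        (n * p.factorial * (n - p).factorial * Real.Gamma (t + n + p)) := by
  induction p with
  | zero => simp
  | succ p ih =>
    rw [Finset.sum_range_succ, ih (by omega)]
    obtain ⟨q, rfl⟩ := Nat.exists_eq_add_of_le hp
    have hp0 : (0 : ℝ) ≤ p := p.cast_nonneg
    have hq0 : (0 : ℝ) ≤ q := q.cast_nonneg
    have htp : t + p ≠ 0 := by
      rcases p with _ | p
      · simpa using ht0
      · push_cast
        have : (0 : ℝ) ≤ p := p.cast_nonneg
        linarith
    have hpos : 0 < t + (p + 1 + q) + p := by linarith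
    have hG := (Real.Gamma_pos_of_pos hpos).ne'
    have hp1 : (p : ℝ) + 1 ≠ 0 := by positivity
    have hq1 : (q : ℝ) + 1 ≠ 0 := by positivity
    have hpq : (p : ℝ) + 1 + q ≠ 0 := by positivity
    have hpf : (p.factorial : ℝ) ≠ 0 := by positivity
    have hqf : (q.factorial : ℝ) ≠ 0 := by positivity
    rw [show p + 1 + q - p = q + 1 by omega, show p + 1 + q - (p + 1) = q by omega,
      Nat.factorial_succ, Nat.factorial_succ]
    push_cast
    rw [show t + 1 + ((p : ℝ) + 1 + q) + p = t + (p + 1 + q) + p + 1 by ring,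
      show t + ((p : ℝ) + 1 + q) + (p + 1) = t + (p + 1 + q) + p + 1 by ring,
      Real.Gamma_add_one hpos.ne', ← add_assoc t (p : ℝ) 1, Real.Gamma_add_one htp]
    have hpos' := hpos.ne'
    field_simp
    ring

lemma sum_range_succ_alternating_Gamma {t : ℝ} (ht : -1 < t) (ht0 : t ≠ 0) (n : ℕ) :
    ∑ l ∈ range (n + 1), (-1 : ℝ) ^ l * (t + 2 * l) * Real.Gamma (t + l) /
        (l.factorial * (n - l).factorial * Real.Gamma (t + 1 + n + l)) =
      if n = 0 then 1 else 0 := by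
  rcases Nat.eq_zero_or_pos n with rfl | hn
  · have : Real.Gamma (t + 1) ≠ 0 := (Real.Gamma_pos_of_pos (by linarith)).ne'
    rw [Real.Gamma_add_one ht0] at this
    simp [Real.Gamma_add_one ht0, div_self this]
  · have hn1 : (1 : ℝ) ≤ n := by exact_mod_cast hn
    have hpos : 0 < t + n + n := by linarith
    have hG := (Real.Gamma_pos_of_pos hpos).ne'
    have hpos' := hpos.ne'
    have hnf : (n.factorial : ℝ) ≠ 0 := by positivity
    rw [Finset.sum_range_succ, sum_range_alternating_Gamma ht ht0 hn le_rfl, if_neg hn.ne',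
      show t + 1 + (n : ℝ) + n = t + n + n + 1 by ring, Real.Gamma_add_one hpos']
    simp only [Nat.sub_self, Nat.factorial_zero, Nat.cast_one]
    field_simp
    ring

lemma Gamma_nat_add_ne_zero {s : ℝ} (hs : -1 < s) (hs0 : s ≠ 0) (i : ℕ) :
    Real.Gamma (s + i) ≠ 0 := by
  refine Real.Gamma_ne_zero fun m hm => ?_
  rcases Nat.eq_zero_or_pos (i + m) with h | h
  · obtain ⟨rfl, rfl⟩ : i = 0 ∧ m = 0 := by omega
    simp at hm
    exact hs0 hm
  · have : (1 : ℝ) ≤ i + m := by exact_mod_cast h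
    linarith

/-- The Pochhammer symbols in `Upsilon` combined into single Gamma values. -/
lemma Upsilon_eq {β γ : ℝ} (hβ : -1 < β) (hγ : -1 < γ) (i k : ℕ) :
    Upsilon β γ i k = (-1) ^ i * (k.factorial : ℝ) / ((k - i).factorial : ℝ) *
      Real.Gamma (1 + γ + k) * Real.Gamma (β + γ + 1 + i) * (β + γ + 1 + 2 * i) /
        (Real.Gamma (1 + γ + i) * Real.Gamma (β + γ + 1 + 1 + k + i)) := by
  have hk : (0 : ℝ) ≤ k := k.cast_nonneg
  have hi : (0 : ℝ) ≤ i := i.cast_nonneg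
  have h1 := (Real.Gamma_pos_of_pos (show 0 < 1 + γ by linarith)).ne'
  have h2 := (Real.Gamma_pos_of_pos (show 0 < 2 + β + γ by linarith)).ne'
  have h3 := (Real.Gamma_pos_of_pos (show 0 < 2 + β + γ + k by linarith)).ne'
  have h4 := (Real.Gamma_pos_of_pos (show 0 < 2 + β + γ + k + i by linarith)).ne'
  have h5 := (Real.Gamma_pos_of_pos (show 0 < 1 + γ + i by linarith)).ne'
  unfold Upsilon poch
  push_cast
  rw [show 2 + β + γ + ((i : ℝ) - 1) = β + γ + 1 + i by ring,
    show 2 + (k : ℝ) + β + γ = 2 + β + γ + k by ring,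
    show β + γ + 1 + 1 + (k : ℝ) + i = 2 + β + γ + k + i by ring]
  field_simp
  ring

/-- Monomials in the basis of shifted Jacobi polynomials. -/
lemma sum_Upsilon_mul_shiftedJacobi {β γ L : ℝ} (hβ : -1 < β) (hγ : -1 < γ)
    (hbg : β + γ + 1 ≠ 0) (k : ℕ) (x : ℝ) :
    ∑ i ∈ range (k + 1), (-1) ^ i * Upsilon β γ i k * shiftedJacobi L β γ i x = (x / L) ^ k := by
  have key : ∀ m ∈ range (k + 1), ∑ i ∈ Finset.Ico m (k + 1), (-1) ^ i * Upsilon β γ i k *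
      ((-1 : ℝ) ^ (i - m) * Real.Gamma ((i : ℝ) + γ + 1) *
        Real.Gamma ((i : ℝ) + (m : ℝ) + β + γ + 1) /
      (Real.Gamma ((m : ℝ) + γ + 1) * Real.Gamma ((i : ℝ) + β + γ + 1) *
        (Nat.factorial (i - m) : ℝ) * (Nat.factorial m : ℝ) * L ^ m) * x ^ m) =
      if m = k then (x / L) ^ k else 0 := by
    intro m hm
    obtain ⟨n, rfl⟩ := Nat.exists_eq_add_of_le (Nat.lt_succ_iff.1 (Finset.mem_range.1 hm))
    have hm0 : (0 : ℝ) ≤ m := m.cast_nonneg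
    have ht : -1 < β + γ + 1 + 2 * m := by linarith
    have ht0 : β + γ + 1 + 2 * (m : ℝ) ≠ 0 := by
      rcases m with _ | m
      · simpa using hbg
      · push_cast
        have : (0 : ℝ) ≤ m := m.cast_nonneg
        linarith
    have hG := (Real.Gamma_pos_of_pos (show 0 < 1 + γ + m by linarith)).ne'
    rw [Finset.sum_Ico_eq_sum_range, show m + n + 1 - m = n + 1 by omega]
    trans ((m + n).factorial * Real.Gamma (1 + γ + (m + n)) /
        (Real.Gamma (1 + γ + m) * m.factorial) * (x / L) ^ m) *
        ∑ l ∈ range (n + 1), (-1 : ℝ) ^ l * (β + γ + 1 + 2 * m + 2 * l) *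
          Real.Gamma (β + γ + 1 + 2 * m + l) / (l.factorial * (n - l).factorial *
            Real.Gamma (β + γ + 1 + 2 * m + 1 + n + l))
    · rw [Finset.mul_sum]
      refine Finset.sum_congr rfl fun l hl => ?_
      have hl0 : (0 : ℝ) ≤ l := l.cast_nonneg
      rw [Upsilon_eq hβ hγ, show m + n - (m + l) = n - l by omega, Nat.add_sub_cancel_left, div_pow]
      push_cast
      have hA := (Real.Gamma_pos_of_pos (show 0 < 1 + γ + (m + l) by linarith)).ne'
      have hB := Gamma_nat_add_ne_zero (s := β + γ + 1) (by linarith) hbg (m + l)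
      push_cast at hB
      rw [show (m : ℝ) + l + γ + 1 = 1 + γ + (m + l) by ring,
        show (m : ℝ) + γ + 1 = 1 + γ + m by ring,
        show (m : ℝ) + l + m + β + γ + 1 = β + γ + 1 + 2 * m + l by ring,
        show (m : ℝ) + l + β + γ + 1 = β + γ + 1 + (m + l) by ring,
        show β + γ + 1 + 1 + ((m : ℝ) + n) + (m + l) = β + γ + 1 + 2 * m + 1 + n + l by ring,
        show β + γ + 1 + 2 * ((m : ℝ) + l) = β + γ + 1 + 2 * m + 2 * l by ring]
      have hsq : (-1 : ℝ) ^ (m + l) * (-1) ^ (m + l) = 1 := by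
        rw [← mul_pow]; norm_num
      generalize Real.Gamma (β + γ + 1 + (m + l)) = B at *
      generalize Real.Gamma (1 + γ + (m + l)) = A at *
      generalize (-1 : ℝ) ^ (m + l) = e at *
      rw [show ∀ u v w z, e * (e * u / v * w * B * z / (A * (Real.Gamma
        (β + γ + 1 + 2 * m + 1 + n + l)))) = e * e * (u / v * w * B * z / (A * (Real.Gamma
        (β + γ + 1 + 2 * m + 1 + n + l)))) by intros; ring, hsq]
      field_simp
    · rw [sum_range_succ_alternating_Gamma ht ht0]
      rcases n with _ | n
      · have : (m.factorial : ℝ) ≠ 0 := by positivity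
        simp
        field_simp
      · simp
  unfold shiftedJacobi
  simp_rw [Finset.mul_sum, Finset.range_eq_Ico]
  rw [← Finset.sum_Ico_Ico_comm]
  rw [← Finset.range_eq_Ico, Finset.sum_congr rfl key]
  simp

/-- the analytic form of the left-side Riemann–Liouville fractional
derivative of order `α` (`1 < α < 2`, base point `0`) of the shifted Jacobi polynomial:
`₀D_x^α J_{L,j}^{β,γ}(x) = Σ_{k=0}^{j} Σ_{i=0}^{k} Θ_{i,j,k}^{α,β,γ} Υ_{i,k}^{β,γ} x^{-α}
J_{L,i}^{β,γ}(x)` for every `x ∈ (0,L)`. -/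
theorem left_RL_deriv_shiftedJacobi (β γ L α : ℝ) (hβ : -1 < β) (hγ : -1 < γ)
    (hbg : β + γ + 1 ≠ 0) (hL : 0 < L) (hα1 : 1 < α) (hα2 : α < 2) (j : ℕ)
    (x : ℝ) (hx : x ∈ Set.Ioo (0:ℝ) L) :
    iteratedDeriv 2
      (fun y : ℝ => (1 / Real.Gamma (2 - α)) *
        ∫ ξ in (0:ℝ)..y, (y - ξ) ^ (1 - α) * shiftedJacobi L β γ j ξ) x
    = ∑ k ∈ Finset.range (j + 1), ∑ i ∈ Finset.range (k + 1),
        Theta α β γ i j k * Upsilon β γ i k * x ^ (-α) * shiftedJacobi L β γ i x := by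
  have h0 : 0 < x := hx.1
  conv_lhs => unfold shiftedJacobi
  rw [iteratedDeriv_two_integral_rpow_mul_sum hα1 hα2 h0]
  refine Finset.sum_congr rfl fun k hk => ?_
  trans (∑ i ∈ Finset.range (k + 1), (-1) ^ i * Upsilon β γ i k * shiftedJacobi L β γ i x) *
    (Theta α β γ 0 j k * x ^ (-α))
  · have hsign : (-1 : ℝ) ^ (j - k) = (-1) ^ (0 + j + k) := by
      obtain ⟨n, rfl⟩ := Nat.exists_eq_add_of_le (Nat.lt_succ_iff.1 (Finset.mem_range.1 hk))
      rw [Nat.add_sub_cancel_left, show 0 + (k + n) + k = n + 2 * k by ring, pow_add, pow_mul]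
      simp
    rw [sum_Upsilon_mul_shiftedJacobi hβ hγ hbg, Real.rpow_sub h0, Real.rpow_neg h0.le,
      Real.rpow_natCast, div_pow, Theta, hsign,
      show (j : ℝ) + γ + 1 = 1 + γ + j by ring, show (k : ℝ) + γ + 1 = 1 + γ + k by ring,
      show (j : ℝ) + k + β + γ + 1 = 1 + β + γ + j + k by ring,
      show (j : ℝ) + β + γ + 1 = 1 + β + γ + j by ring, add_comm 1 (k : ℝ),
      Real.Gamma_nat_eq_factorial]
    ring
  · rw [Finset.sum_mul]
    refine Finset.sum_congr rfl fun i _ => ?_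
    simp only [Theta, pow_add, Nat.zero_add]
    ring
end

section
/- Let β, γ > −1 with β + γ + 1 ≠ 0, let L > 0, let 1 < α < 2, and let j be a nonnegative integer. Then for every x ∈ (0, L), the right-side Riemann–Liouville fractional derivative of the shifted Jacobi polynomial satisfies ₓD_L^α J_{L,j}^{β,γ}(x) = Σ_{k=0}^{j} Σ_{i=0}^{k} Θ̄_{j,k}^{α,β,γ} · Ῡ_{i,k}^{β,γ} · (L−x)^{−α} · J_{L,i}^{β,γ}(x), where Θ̄_{j,k}^{α,β,γ} = (−1)^{k} Γ(1+β+γ+j+k) Γ(1+β+j) Γ(1+k) / [Γ(1+β+γ+j) Γ(1+β+k) Γ(1+k−α) (j−k)! k!] and Ῡ_{i,k}^{β,γ} = (−k)_i (1+β)_k (2+β+γ)_{i−1} (1+β+γ+2i) / [(1+β)_i (2+β+γ)_k (2+k+β+γ)_i]. -/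
open Real Finset MeasureTheory

/-- The coefficient `Θ̄_{j,k}^{α,β,γ}`. -/
noncomputable def ThetaBar (α β γ : ℝ) (j k : ℕ) : ℝ :=
  (-1 : ℝ) ^ k * Real.Gamma (1 + β + γ + (j : ℝ) + (k : ℝ)) *
      Real.Gamma (1 + β + (j : ℝ)) * Real.Gamma (1 + (k : ℝ)) /
    (Real.Gamma (1 + β + γ + (j : ℝ)) * Real.Gamma (1 + β + (k : ℝ)) *
      Real.Gamma (1 + (k : ℝ) - α) * (Nat.factorial (j - k) : ℝ) * (Nat.factorial k : ℝ))

/-- The coefficient `Ῡ_{i,k}^{β,γ}`, with `(-k)_i = (-1)^i k!/(k-i)!`. -/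
noncomputable def UpsilonBar (β γ : ℝ) (i k : ℕ) : ℝ :=
  ((-1 : ℝ) ^ i * (Nat.factorial k : ℝ) / (Nat.factorial (k - i) : ℝ)) * poch (1 + β) k *
      poch (2 + β + γ) ((i : ℤ) - 1) * (1 + β + γ + 2 * (i : ℝ)) /
    (poch (1 + β) i * poch (2 + β + γ) k * poch (2 + (k : ℝ) + β + γ) i)

/-- The Gamma function does not vanish at nonzero reals above `-1`. -/
lemma Gamma_ne_zero_of_neg_one_lt {s : ℝ} (h : -1 < s) (h0 : s ≠ 0) : Real.Gamma s ≠ 0 := by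
  refine Real.Gamma_ne_zero fun m hm => ?_
  rcases Nat.eq_zero_or_pos m with rfl | hpos
  · exact h0 (by simpa using hm)
  · have : (1 : ℝ) ≤ m := by exact_mod_cast hpos
    linarith

/-- Reindexing of a sum over a triangle by its columns. -/
lemma sum_range_triangle {M : Type*} [AddCommMonoid M] (F : ℕ → ℕ → M) (j : ℕ) :
    ∑ i ∈ range (j + 1), ∑ k ∈ range (i + 1), F i k =
      ∑ k ∈ range (j + 1), ∑ r ∈ range (j - k + 1), F (k + r) k := by
  rw [Finset.sum_comm' (t' := range (j + 1)) (s' := fun k => Finset.Ico k (j + 1))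
    (by intro i k; simp only [Finset.mem_range, Finset.mem_Ico]; omega)]
  refine Finset.sum_congr rfl fun k hk => ?_
  rw [Finset.sum_Ico_eq_sum_range, Nat.succ_sub (by simpa [Nat.lt_succ_iff] using hk)]

lemma prod_mul_Gamma {B : ℝ} (hB : 0 < B) (n : ℕ) :
    (∏ l ∈ range n, (B + n - 1 - l)) * Real.Gamma B = Real.Gamma (B + n) := by
  induction n generalizing B with
  | zero => simp
  | succ n ih =>
    rw [Finset.prod_range_succ, mul_assoc]
    have h := ih (B := B + 1) (by linarith)
    rw [Real.Gamma_add_one hB.ne'] at h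
    push_cast
    rw [show B + (n + 1 : ℝ) = B + 1 + n by ring, ← h]
    congr 1
    congr 1
    ring

lemma fwdDiff_iter_Gamma_div {A C : ℝ} (hA : ∀ y : ℕ, A + y ≠ 0) (hC : 0 < C) (n y : ℕ) :
    (fwdDiff 1)^[n] (fun y : ℕ => Real.Gamma (A + y) / Real.Gamma (C + y)) y =
      (∏ l ∈ range n, (A - C - l)) * Real.Gamma (A + y) / Real.Gamma (C + n + y) := by
  induction n generalizing y with
  | zero => simp
  | succ n ih =>
    rw [Function.iterate_succ_apply', fwdDiff, ih, ih, Finset.prod_range_succ]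
    have hpos : 0 < C + n + y := by positivity
    have h1 := Real.Gamma_add_one (hA y)
    have h2 := Real.Gamma_add_one hpos.ne'
    have h3 := (Real.Gamma_pos_of_pos hpos).ne'
    push_cast
    rw [show A + (y + 1 : ℝ) = A + y + 1 by ring, show C + n + (y + 1 : ℝ) = C + n + y + 1 by ring,
      show C + (n + 1 : ℝ) + y = C + n + y + 1 by ring, h1, h2]
    field_simp
    ring

/-- The Chu–Vandermonde summation, in terms of Gamma functions. -/
lemma sum_Gamma_div_Gamma {B C : ℝ} (n : ℕ) (hA : ∀ y : ℕ, B + C + n - 1 + y ≠ 0) (hC : 0 < C)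
    (hB : 0 < B) :
    ∑ r ∈ range (n + 1), (-1 : ℝ) ^ (n - r) * (n.choose r : ℝ) *
        (Real.Gamma (B + C + n - 1 + r) / Real.Gamma (C + r)) =
      Real.Gamma (B + n) / Real.Gamma B * (Real.Gamma (B + C + n - 1) / Real.Gamma (C + n)) := by
  have h := fwdDiff_iter_Gamma_div hA hC n 0
  rw [fwdDiff_iter_eq_sum_shift] at h
  have hG := (Real.Gamma_pos_of_pos hB).ne'
  rw [← prod_mul_Gamma hB, mul_div_cancel_right₀ _ hG]
  convert h using 1
  · refine Finset.sum_congr rfl fun r _ => ?_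
    simp
  · rw [← mul_div_assoc]
    simp only [Nat.cast_zero, add_zero]
    rw [Finset.prod_congr rfl fun (l : ℕ) _ =>
      show B + n - 1 - (l : ℝ) = B + C + n - 1 - C - l by ring]

/-- The shifted Jacobi polynomial expanded in powers of `L - x`. -/
lemma shiftedJacobi_eq_sum_sub_pow {β γ L : ℝ} (hβ : -1 < β) (hγ : -1 < γ)
    (hbg : β + γ + 1 ≠ 0) (hL : L ≠ 0) (j : ℕ) (x : ℝ) :
    shiftedJacobi L β γ j x = ∑ k ∈ range (j + 1),
      (-1 : ℝ) ^ k * Real.Gamma (j + k + β + γ + 1) * Real.Gamma (j + β + 1) /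
        (Real.Gamma (j + β + γ + 1) * Real.Gamma (k + β + 1) * ((j - k).factorial : ℝ) *
          (k.factorial : ℝ)) * ((L - x) / L) ^ k := by
  have hexp (i : ℕ) : x ^ i = L ^ i *
      ∑ k ∈ range (i + 1), (-1 : ℝ) ^ k * ((L - x) / L) ^ k * (i.choose k : ℝ) := by
    have h := add_pow (-((L - x) / L)) 1 i
    have hx : x = L * (-((L - x) / L) + 1) := by
      field_simp
      ring
    conv_lhs => rw [hx, mul_pow, h]
    congr 1
    refine Finset.sum_congr rfl fun k _ => ?_
    rw [neg_pow, one_pow, mul_one]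
  unfold shiftedJacobi
  simp only [hexp, Finset.mul_sum]
  rw [sum_range_triangle]
  refine Finset.sum_congr rfl fun k hk => ?_
  obtain ⟨n, rfl⟩ := Nat.exists_eq_add_of_le (Nat.lt_succ_iff.mp (Finset.mem_range.mp hk))
  have hk0 : (0 : ℝ) ≤ k := k.cast_nonneg
  have hn0 : (0 : ℝ) ≤ n := n.cast_nonneg
  have hB : 0 < k + β + 1 := by linarith
  have hC : 0 < k + γ + 1 := by linarith
  have hA (y : ℕ) : (k + β + 1 : ℝ) + (k + γ + 1) + n - 1 + y ≠ 0 := by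
    have hy0 : (0 : ℝ) ≤ y := y.cast_nonneg
    rcases Nat.eq_zero_or_pos (2 * k + n + y) with h | h
    · obtain ⟨rfl, rfl, rfl⟩ : k = 0 ∧ n = 0 ∧ y = 0 := by omega
      intro h'
      apply hbg
      simp at h'
      linarith
    · have : (1 : ℝ) ≤ 2 * k + n + y := by exact_mod_cast h
      intro h'
      linarith
  have hΓj : Real.Gamma (k + n + β + γ + 1) ≠ 0 := by
    apply Gamma_ne_zero_of_neg_one_lt (by linarith)
    rcases Nat.eq_zero_or_pos (k + n) with h | h
    · obtain ⟨rfl, rfl⟩ : k = 0 ∧ n = 0 := by omega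
      simpa using hbg
    · have : (1 : ℝ) ≤ k + n := by exact_mod_cast h
      linarith
  have hsum := sum_Gamma_div_Gamma n hA hC hB
  have hΓB := (Real.Gamma_pos_of_pos hB).ne'
  have hΓCn : Real.Gamma (k + γ + 1 + n) ≠ 0 := (Real.Gamma_pos_of_pos (by linarith)).ne'
  simp only [Nat.add_sub_cancel_left]
  trans (-1 : ℝ) ^ k * ((L - x) / L) ^ k * Real.Gamma (k + γ + 1 + n) /
      (Real.Gamma (k + n + β + γ + 1) * n.factorial * k.factorial) *
      ∑ r ∈ range (n + 1), (-1 : ℝ) ^ (n - r) * (n.choose r : ℝ) *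
        (Real.Gamma ((k + β + 1 : ℝ) + (k + γ + 1) + n - 1 + r) / Real.Gamma (k + γ + 1 + r))
  · rw [Finset.mul_sum]
    refine Finset.sum_congr rfl fun r hr => ?_
    have hrn : r ≤ n := Nat.lt_succ_iff.mp (Finset.mem_range.mp hr)
    have hr0 : (0 : ℝ) ≤ r := r.cast_nonneg
    have hΓCr : Real.Gamma (k + γ + 1 + r) ≠ 0 := (Real.Gamma_pos_of_pos (by linarith)).ne'
    rw [Nat.cast_choose ℝ hrn, Nat.cast_choose ℝ (Nat.le_add_right k r),
      Nat.add_sub_cancel_left, Nat.add_sub_add_left]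
    push_cast
    rw [show (k + n + γ + 1 : ℝ) = k + γ + 1 + n by ring,
      show (k + r + γ + 1 : ℝ) = k + γ + 1 + r by ring,
      show (k + n + (k + r) + β + γ + 1 : ℝ) = k + β + 1 + (k + γ + 1) + n - 1 + r by ring]
    have h1 : ((k + r).factorial : ℝ) ≠ 0 := by positivity
    field_simp
  · rw [hsum]
    push_cast
    rw [show (k + n + k + β + γ + 1 : ℝ) = k + β + 1 + (k + γ + 1) + n - 1 by ring,
      show (k + n + β + 1 : ℝ) = k + β + 1 + n by ring]
    field_simp

/-- A telescoping alternating sum behind the inversion of the Jacobi expansion. -/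
lemma sum_alternating_Gamma_div_Gamma {a : ℝ} (ha : -1 < a) (ha0 : a ≠ 0) (n : ℕ) :
    ∑ r ∈ range (n + 1), (-1 : ℝ) ^ r * (a + 2 * r) * Real.Gamma (a + r) /
        (((n - r).factorial : ℝ) * (r.factorial : ℝ) * Real.Gamma (1 + n + a + r)) =
      if n = 0 then 1 else 0 := by
  rcases Nat.eq_zero_or_pos n with rfl | hn
  · have h := Gamma_ne_zero_of_neg_one_lt ha ha0
    simp only [zero_add, Finset.sum_range_one, if_true]
    simp only [Nat.cast_zero, mul_zero, add_zero, pow_zero, one_mul, Nat.factorial_zero,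
      Nat.cast_one, Nat.sub_self]
    rw [add_comm 1 a, Real.Gamma_add_one ha0]
    field_simp
  rw [if_neg hn.ne']
  have hn1 : (1 : ℝ) ≤ n := by exact_mod_cast hn
  have key (m : ℕ) (hm : m ≤ n) :
      ∑ r ∈ range m, (-1 : ℝ) ^ r * (a + 2 * r) * Real.Gamma (a + r) /
        (((n - r).factorial : ℝ) * (r.factorial : ℝ) * Real.Gamma (1 + n + a + r)) =
      -((-1 : ℝ) ^ m * m * Real.Gamma (a + m) /
        (n * ((n - m).factorial : ℝ) * (m.factorial : ℝ) * Real.Gamma (n + a + m))) := by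
    induction m with
    | zero => simp
    | succ m ih =>
      rw [Finset.sum_range_succ, ih (by omega)]
      obtain ⟨q, rfl⟩ : ∃ q, n = m + 1 + q := Nat.exists_eq_add_of_le hm
      have hm0 : (0 : ℝ) ≤ m := m.cast_nonneg
      have ham : a + m ≠ 0 := by
        rcases Nat.eq_zero_or_pos m with rfl | h
        · simpa using ha0
        · have : (1 : ℝ) ≤ m := by exact_mod_cast h
          linarith
      have hpos : 0 < ((m + 1 + q : ℕ) : ℝ) + a + m := by linarith
      have h1 := Real.Gamma_add_one ham
      have h2 := Real.Gamma_add_one hpos.ne'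
      have h3 := (Real.Gamma_pos_of_pos hpos).ne'
      rw [show m + 1 + q - m = q + 1 by omega, show m + 1 + q - (m + 1) = q by omega,
        Nat.factorial_succ, Nat.factorial_succ,
        show 1 + ((m + 1 + q : ℕ) : ℝ) + a + m = ((m + 1 + q : ℕ) : ℝ) + a + m + 1 by ring,
        show ((m + 1 + q : ℕ) : ℝ) + a + (m + 1 : ℕ) = ((m + 1 + q : ℕ) : ℝ) + a + m + 1 by
          push_cast; ring,
        show a + ((m + 1 : ℕ) : ℝ) = a + m + 1 by push_cast; ring, h1, h2]
      generalize Real.Gamma (((m + 1 + q : ℕ) : ℝ) + a + m) = G at *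
      push_cast at *
      field_simp
      ring
  rw [Finset.sum_range_succ, key n le_rfl]
  have hpos : 0 < (n : ℝ) + a + n := by linarith
  have h2 := Real.Gamma_add_one hpos.ne'
  have h3 := (Real.Gamma_pos_of_pos hpos).ne'
  rw [show (1 + n + a + n : ℝ) = n + a + n + 1 by ring, h2]
  field_simp
  ring

lemma UpsilonBar_eq {β γ : ℝ} (hβ : -1 < β) (hγ : -1 < γ) (i k : ℕ) :
    UpsilonBar β γ i k = (-1 : ℝ) ^ i * (k.factorial : ℝ) * Real.Gamma (k + β + 1) *
      Real.Gamma (i + β + γ + 1) * (β + γ + 1 + 2 * i) /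
      (((k - i).factorial : ℝ) * Real.Gamma (i + β + 1) *
        Real.Gamma (1 + k + (β + γ + 1) + i)) := by
  have hk0 : (0 : ℝ) ≤ k := k.cast_nonneg
  have hi0 : (0 : ℝ) ≤ i := i.cast_nonneg
  have h1 : Real.Gamma (1 + β) ≠ 0 := (Real.Gamma_pos_of_pos (by linarith)).ne'
  have h2 : Real.Gamma (2 + β + γ) ≠ 0 := (Real.Gamma_pos_of_pos (by linarith)).ne'
  have h3 : Real.Gamma (2 + β + γ + k) ≠ 0 := (Real.Gamma_pos_of_pos (by linarith)).ne'
  have h4 : Real.Gamma (i + β + 1) ≠ 0 := (Real.Gamma_pos_of_pos (by linarith)).ne'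
  have h5 : Real.Gamma (1 + k + (β + γ + 1) + i) ≠ 0 :=
    (Real.Gamma_pos_of_pos (by linarith)).ne'
  unfold UpsilonBar poch
  push_cast
  rw [show 1 + β + k = k + β + 1 by ring, show 1 + β + i = i + β + 1 by ring,
    show 2 + β + γ + (i - 1) = i + β + γ + 1 by ring,
    show 2 + k + β + γ + i = 1 + k + (β + γ + 1) + i by ring,
    show 2 + k + β + γ = 2 + β + γ + k by ring]
  field_simp
  ring

/-- Powers of `(L - x) / L` expanded in shifted Jacobi polynomials. -/
lemma sum_UpsilonBar_mul_shiftedJacobi {β γ L : ℝ} (hβ : -1 < β) (hγ : -1 < γ)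
    (hbg : β + γ + 1 ≠ 0) (hL : L ≠ 0) (k : ℕ) (x : ℝ) :
    ∑ i ∈ range (k + 1), UpsilonBar β γ i k * shiftedJacobi L β γ i x = ((L - x) / L) ^ k := by
  simp only [shiftedJacobi_eq_sum_sub_pow hβ hγ hbg hL, Finset.mul_sum]
  rw [sum_range_triangle]
  trans ∑ m ∈ range (k + 1), if m = k then ((L - x) / L) ^ k else 0
  · refine Finset.sum_congr rfl fun m hm => ?_
    obtain ⟨n, rfl⟩ := Nat.exists_eq_add_of_le (Nat.lt_succ_iff.mp (Finset.mem_range.mp hm))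
    have hm0 : (0 : ℝ) ≤ m := m.cast_nonneg
    have ha0 : β + γ + 1 + 2 * m ≠ 0 := by
      rcases Nat.eq_zero_or_pos m with rfl | h
      · simpa using hbg
      · have : (1 : ℝ) ≤ m := by exact_mod_cast h
        linarith
    have hsum := sum_alternating_Gamma_div_Gamma (by linarith) ha0 n
    have hΓm : Real.Gamma (m + β + 1) ≠ 0 := (Real.Gamma_pos_of_pos (by linarith)).ne'
    rw [Nat.add_sub_cancel_left]
    trans ((m + n).factorial : ℝ) * Real.Gamma ((m + n : ℕ) + β + 1) /
        (Real.Gamma (m + β + 1) * m.factorial) * ((L - x) / L) ^ m *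
        ∑ r ∈ range (n + 1), (-1 : ℝ) ^ r * (β + γ + 1 + 2 * m + 2 * r) *
          Real.Gamma (β + γ + 1 + 2 * m + r) / (((n - r).factorial : ℝ) * (r.factorial : ℝ) *
            Real.Gamma (1 + n + (β + γ + 1 + 2 * m) + r))
    · rw [Finset.mul_sum]
      refine Finset.sum_congr rfl fun r hr => ?_
      have hr0 : (0 : ℝ) ≤ r := r.cast_nonneg
      have hn0 : (0 : ℝ) ≤ n := n.cast_nonneg
      have hmr : Real.Gamma ((m + r : ℕ) + β + γ + 1) ≠ 0 := by
        push_cast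
        apply Gamma_ne_zero_of_neg_one_lt (by linarith)
        rcases Nat.eq_zero_or_pos (m + r) with h | h
        · obtain ⟨rfl, rfl⟩ : m = 0 ∧ r = 0 := by omega
          simpa using hbg
        · have : (1 : ℝ) ≤ m + r := by exact_mod_cast h
          linarith
      have hΓmr : Real.Gamma ((m + r : ℕ) + β + 1) ≠ 0 :=
        (Real.Gamma_pos_of_pos (by push_cast; linarith)).ne'
      have hΓ : Real.Gamma (1 + n + (β + γ + 1 + 2 * m) + r) ≠ 0 :=
        (Real.Gamma_pos_of_pos (by linarith)).ne'
      rw [UpsilonBar_eq hβ hγ, Nat.add_sub_add_left, Nat.add_sub_cancel_left,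
        show 1 + ((m + n : ℕ) : ℝ) + (β + γ + 1) + (m + r : ℕ) =
          1 + n + (β + γ + 1 + 2 * m) + r by push_cast; ring,
        show ((m + r : ℕ) : ℝ) + m + β + γ + 1 = β + γ + 1 + 2 * m + r by push_cast; ring,
        show β + γ + 1 + 2 * ((m + r : ℕ) : ℝ) = β + γ + 1 + 2 * m + 2 * r by push_cast; ring,
        pow_add]
      generalize (L - x) / L = u
      rcases neg_one_pow_eq_or ℝ m with h | h <;> rw [h] <;> field_simp
    · rw [hsum]
      rcases Nat.eq_zero_or_pos n with rfl | hn
      · simp only [if_true, add_zero, mul_one]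
        field_simp
      · rw [if_neg hn.ne', if_neg (by omega), mul_zero]
  · simp

lemma intervalIntegral_rpow_mul_sub_pow {s a : ℝ} (hs : 0 < s) (ha : 0 < a) (k : ℕ) :
    ∫ t in (0 : ℝ)..a, t ^ (s - 1) * (a - t) ^ k =
      a ^ (s + k) * (Real.Gamma s * (k.factorial : ℝ) / Real.Gamma (s + k + 1)) := by
  have h := Complex.betaIntegral_scaled (s : ℂ) ((k : ℂ) + 1) ha
  rw [Complex.betaIntegral_eq_Gamma_mul_div _ _ (by simpa using hs)
    (by simp; positivity), Complex.Gamma_nat_eq_factorial, Complex.Gamma_ofReal,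
    show (s : ℂ) + (k + 1) = ((s + k + 1 : ℝ) : ℂ) by push_cast; ring, Complex.Gamma_ofReal,
    show ((s + k + 1 : ℝ) : ℂ) - 1 = ((s + k : ℝ) : ℂ) by push_cast; ring,
    ← Complex.ofReal_cpow ha.le] at h
  have h' : ((∫ t in (0 : ℝ)..a, t ^ (s - 1) * (a - t) ^ k : ℝ) : ℂ) =
      ∫ t in (0 : ℝ)..a, (t : ℂ) ^ ((s : ℂ) - 1) * ((a : ℂ) - t) ^ ((k : ℂ) + 1 - 1) := by
    rw [← intervalIntegral.integral_ofReal]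
    refine intervalIntegral.integral_congr fun t ht => ?_
    rw [Set.uIcc_of_le ha.le] at ht
    simp only [add_sub_cancel_right, Complex.cpow_natCast]
    rw [show (s : ℂ) - 1 = ((s - 1 : ℝ) : ℂ) by push_cast; ring, ← Complex.ofReal_cpow ht.1]
    push_cast
    ring
  rw [h] at h'
  exact_mod_cast h'

/-- The fractional integral with base point `L` of a power of `L - ξ`. -/
lemma intervalIntegral_sub_rpow_mul_sub_pow {s y L : ℝ} (hs : 0 < s) (hy : y < L) (k : ℕ) :
    ∫ ξ in y..L, (ξ - y) ^ (s - 1) * (L - ξ) ^ k =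
      (L - y) ^ (s + k) * (Real.Gamma s * (k.factorial : ℝ) / Real.Gamma (s + k + 1)) := by
  rw [← intervalIntegral_rpow_mul_sub_pow hs (sub_pos.mpr hy), ← sub_self y,
    ← intervalIntegral.integral_comp_sub_right]
  refine intervalIntegral.integral_congr fun t _ => ?_
  simp only [sub_sub_sub_cancel_right]

lemma intervalIntegrable_sub_rpow_mul_sub_pow {s y L : ℝ} (hs : 0 < s) (k : ℕ) :
    IntervalIntegrable (fun ξ => (ξ - y) ^ (s - 1) * (L - ξ) ^ k) volume y L := by
  refine IntervalIntegrable.mul_continuousOn ?_ (by fun_prop)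
  have h := (intervalIntegral.intervalIntegrable_rpow' (a := 0) (b := L - y)
    (r := s - 1) (by linarith)).comp_sub_right y
  simpa using h

lemma deriv_const_sub_rpow {L y : ℝ} (hy : y < L) (p : ℝ) :
    HasDerivAt (fun z => (L - z) ^ p) (-(p * (L - y) ^ (p - 1))) y := by
  have h := ((hasDerivAt_id y).const_sub L).rpow_const (p := p) (Or.inl (sub_pos.mpr hy).ne')
  rw [neg_one_mul, neg_mul] at h
  exact h

lemma iteratedDeriv_two_sum_sub_rpow {L x : ℝ} (hx : x < L) (s : Finset ℕ) (c p : ℕ → ℝ)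
    {f : ℝ → ℝ} (hf : ∀ y < L, f y = ∑ k ∈ s, c k * (L - y) ^ p k) :
    iteratedDeriv 2 f x = ∑ k ∈ s, c k * (p k * (p k - 1)) * (L - x) ^ (p k - 2) := by
  have h1 (y : ℝ) (hy : y < L) :
      deriv f y = ∑ k ∈ s, c k * -(p k * (L - y) ^ (p k - 1)) := by
    have he : f =ᶠ[nhds y] fun y => ∑ k ∈ s, c k * (L - y) ^ p k := by
      filter_upwards [Iio_mem_nhds hy] with z hz using hf z hz
    rw [he.deriv_eq]
    exact (HasDerivAt.fun_sum fun k _ => (deriv_const_sub_rpow hy (p k)).const_mul (c k)).deriv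
  rw [iteratedDeriv_succ, iteratedDeriv_one]
  have he : deriv f =ᶠ[nhds x] fun y => ∑ k ∈ s, c k * -(p k * (L - y) ^ (p k - 1)) := by
    filter_upwards [Iio_mem_nhds hx] with z hz using h1 z hz
  rw [he.deriv_eq]
  refine ((HasDerivAt.fun_sum fun k _ => (((deriv_const_sub_rpow hx (p k - 1)).const_mul
    (p k)).neg.const_mul (c k))).deriv).trans (Finset.sum_congr rfl fun k _ => ?_)
  rw [show p k - 1 - 1 = p k - 2 by ring]
  ring

/-- the analytic form of the right-side Riemann–Liouville fractional
derivative of order `α` (`1 < α < 2`, base point `L`) of the shifted Jacobi polynomial: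
`ₓD_L^α J_{L,j}^{β,γ}(x) = Σ_{k=0}^{j} Σ_{i=0}^{k} Θ̄_{j,k}^{α,β,γ} Ῡ_{i,k}^{β,γ} (L-x)^{-α}
J_{L,i}^{β,γ}(x)` for every `x ∈ (0,L)`. -/
theorem right_RL_deriv_shiftedJacobi (β γ L α : ℝ) (hβ : -1 < β) (hγ : -1 < γ)
    (hbg : β + γ + 1 ≠ 0) (hL : 0 < L) (hα1 : 1 < α) (hα2 : α < 2) (j : ℕ)
    (x : ℝ) (hx : x ∈ Set.Ioo (0:ℝ) L) :
    iteratedDeriv 2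
      (fun y : ℝ => (1 / Real.Gamma (2 - α)) *
        ∫ ξ in y..L, (ξ - y) ^ (1 - α) * shiftedJacobi L β γ j ξ) x
    = ∑ k ∈ Finset.range (j + 1), ∑ i ∈ Finset.range (k + 1),
        ThetaBar α β γ j k * UpsilonBar β γ i k * (L - x) ^ (-α)
          * shiftedJacobi L β γ i x := by
  have hL0 := hL.ne'
  have hs : 0 < 2 - α := by linarith
  have hΓs := (Real.Gamma_pos_of_pos hs).ne'
  set d : ℕ → ℝ := fun k =>
    (-1 : ℝ) ^ k * Real.Gamma (j + k + β + γ + 1) * Real.Gamma (j + β + 1) /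
        (Real.Gamma (j + β + γ + 1) * Real.Gamma (k + β + 1) * ((j - k).factorial : ℝ) *
          (k.factorial : ℝ)) / L ^ k with hd
  rw [iteratedDeriv_two_sum_sub_rpow hx.2 (range (j + 1))
    (fun k => d k * ((k.factorial : ℝ) / Real.Gamma (2 - α + k + 1))) (fun k => 2 - α + k)]
  · refine Finset.sum_congr rfl fun k _ => ?_
    have hxL : 0 < L - x := sub_pos.mpr hx.2
    have hk0 : (0 : ℝ) ≤ k := k.cast_nonneg
    have h1 : 2 - α + k ≠ 0 := by linarith
    have h0 : 1 + k - α ≠ 0 := by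
      rcases Nat.eq_zero_or_pos k with rfl | h
      · simp only [Nat.cast_zero, add_zero]
        linarith
      · have : (1 : ℝ) ≤ k := by exact_mod_cast h
        linarith
    have h2 := Gamma_ne_zero_of_neg_one_lt (by linarith) h0
    have hpow : (L - x) ^ (2 - α + k - 2) = (L - x) ^ (-α) * (L - x) ^ k := by
      rw [← Real.rpow_natCast, ← Real.rpow_add hxL]
      congr 1
      ring
    have hinv := sum_UpsilonBar_mul_shiftedJacobi hβ hγ hbg hL0 k x
    trans ThetaBar α β γ j k * (L - x) ^ (-α) * ((L - x) / L) ^ k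
    · rw [hpow, div_pow, Real.Gamma_add_one h1, show 2 - α + k = 1 + k - α + 1 by ring,
        Real.Gamma_add_one h0, hd, ThetaBar, add_comm 1 (k : ℝ), Real.Gamma_nat_eq_factorial,
        show 1 + β + γ + j + k = j + k + β + γ + 1 by ring,
        show 1 + β + γ + j = j + β + γ + 1 by ring, show 1 + β + j = j + β + 1 by ring,
        show 1 + β + k = k + β + 1 by ring, add_comm (k : ℝ) 1]
      have h3 : 1 + k - α + 1 ≠ 0 := by linarith
      have h4 : (k.factorial : ℝ) ≠ 0 := by positivity
      field_simp
      ring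
    · rw [← hinv, Finset.mul_sum]
      refine Finset.sum_congr rfl fun i _ => ?_
      ring
  · intro y hy
    have hexp (ξ : ℝ) : (ξ - y) ^ (1 - α) * shiftedJacobi L β γ j ξ =
        ∑ k ∈ range (j + 1), d k * ((ξ - y) ^ (2 - α - 1) * (L - ξ) ^ k) := by
      rw [shiftedJacobi_eq_sum_sub_pow hβ hγ hbg hL0, Finset.mul_sum]
      refine Finset.sum_congr rfl fun k _ => ?_
      rw [show 2 - α - 1 = 1 - α by ring, div_pow]
      ring
    simp only [hexp]
    rw [intervalIntegral.integral_finsetSum fun k _ =>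
      (intervalIntegrable_sub_rpow_mul_sub_pow hs k).const_mul (d k), Finset.mul_sum]
    refine Finset.sum_congr rfl fun k _ => ?_
    rw [intervalIntegral.integral_const_mul, intervalIntegral_sub_rpow_mul_sub_pow hs hy]
    field_simp
end

section
/- Let β, γ > −1 with β + γ + 1 ≠ 0, let L > 0, and let i be a nonnegative integer. Then for every real x, x^i = [(γ+1)_i / (β+γ+2)_i] · Σ_{k=0}^{i} [ (−1)^k L^i (−i)_k (β+γ+2k+1) (β+γ+2)_{k−1} / ((1+γ)_k (β+γ+i+2)_k) ] · J_{L,k}^{β,γ}(x); that is, the monomial x^i expands in the shifted Jacobi basis with these explicit coefficients. -/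
open Real Finset

/-- Partial sums of the alternating hypergeometric sum, in closed form. -/
theorem sum_range_alternating_gamma (a : ℝ) (n : ℕ) (hn : n ≠ 0) (ha : ∀ m : ℕ, a + m ≠ 0)
    (ha' : ∀ m : ℕ, 0 < a + n + m + 1) (M : ℕ) (hM : M ≤ n) :
    ∑ m ∈ Finset.range (M + 1), (-1 : ℝ) ^ m * (a + 2 * m) * Real.Gamma (a + m) /
        ((Nat.factorial (n - m) : ℝ) * (Nat.factorial m : ℝ) * Real.Gamma (a + n + m + 1)) =
      (-1 : ℝ) ^ M * ((n : ℝ) - M) * Real.Gamma (a + M + 1) /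
        (n * (Nat.factorial (n - M) : ℝ) * (Nat.factorial M : ℝ) *
          Real.Gamma (a + n + M + 1)) := by
  have hn' : (n : ℝ) ≠ 0 := by exact_mod_cast hn
  induction M with
  | zero =>
    have h0 : a ≠ 0 := by simpa using ha 0
    have h1 := (Real.Gamma_pos_of_pos (ha' 0)).ne'
    have h2 := Real.Gamma_add_one h0
    have h3 : (Nat.factorial n : ℝ) ≠ 0 := by positivity
    simp only [Nat.cast_zero, add_zero] at h1
    simp only [zero_add, Finset.sum_range_one, Nat.cast_zero, add_zero, Nat.sub_zero, pow_zero,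
      Nat.factorial_zero, Nat.cast_one, h2]
    field_simp
    ring
  | succ M ih =>
    rw [Finset.sum_range_succ, ih (by omega)]
    obtain ⟨r, rfl⟩ := Nat.exists_eq_add_of_le hM
    have e1 : M + 1 + r - M = r + 1 := by omega
    have e2 : M + 1 + r - (M + 1) = r := by omega
    have g1 : Real.Gamma (a + ((M + 1 : ℕ) : ℝ) + 1) =
        (a + M + 1) * Real.Gamma (a + M + 1) := by
      rw [← Real.Gamma_add_one]
      · push_cast; ring_nf
      · have := ha (M + 1); push_cast at this; rwa [← add_assoc] at this
    have g2 : Real.Gamma (a + ((M + 1 + r : ℕ) : ℝ) + ((M + 1 : ℕ) : ℝ) + 1) =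
        (a + ((M + 1 + r : ℕ) : ℝ) + M + 1) *
          Real.Gamma (a + ((M + 1 + r : ℕ) : ℝ) + M + 1) := by
      rw [← Real.Gamma_add_one (ha' M).ne']
      push_cast; ring_nf
    have g3 : a + ((M + 1 : ℕ) : ℝ) = a + M + 1 := by push_cast; ring
    have p1 := (Real.Gamma_pos_of_pos (ha' M)).ne'
    have p2 := (ha' M).ne'
    rw [g2, g1, g3, e1, e2, Nat.factorial_succ, Nat.factorial_succ, pow_succ]
    generalize Real.Gamma (a + M + 1) = G at *
    generalize Real.Gamma (a + ((M + 1 + r : ℕ) : ℝ) + M + 1) = H at *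
    have f1 : (Nat.factorial r : ℝ) ≠ 0 := by positivity
    have f2 : (Nat.factorial M : ℝ) ≠ 0 := by positivity
    have f3 : (r : ℝ) + 1 ≠ 0 := by positivity
    have f4 : (M : ℝ) + 1 ≠ 0 := by positivity
    push_cast at *
    field_simp
    ring

/-- The Gamma-function orthogonality relation inverting the shifted Jacobi coefficients. -/
theorem sum_Ico_alternating_gamma (s : ℝ) (hs : -1 < s) (hs0 : s ≠ 0) (i j : ℕ) (hj : j < i) :
    ∑ k ∈ Finset.Ico j (i + 1), (-1 : ℝ) ^ (k - j) * (s + 2 * k) * Real.Gamma (k + j + s) /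
        ((Nat.factorial (i - k) : ℝ) * (Nat.factorial (k - j) : ℝ) *
          Real.Gamma (s + 1 + i + k)) = 0 := by
  obtain ⟨n, rfl⟩ := Nat.exists_eq_add_of_lt hj
  have key := sum_range_alternating_gamma (s + 2 * j) (n + 1) (by omega) ?_ ?_ (n + 1) le_rfl
  · rw [sub_self, mul_zero, zero_mul, zero_div] at key
    rw [Finset.sum_Ico_eq_sum_range, ← key]
    have e : j + n + 1 + 1 - j = n + 1 + 1 := by omega
    rw [e]
    refine Finset.sum_congr rfl fun m _ => ?_
    have e1 : j + m - j = m := by omega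
    have e2 : j + n + 1 - (j + m) = n + 1 - m := by omega
    rw [e1, e2]
    push_cast
    ring_nf
  · intro m h
    rcases Nat.eq_zero_or_pos (2 * j + m) with h0 | h0
    · have hj0 : j = 0 := by omega
      have hm0 : m = 0 := by omega
      subst hj0 hm0
      simp at h
      exact hs0 h
    · have : (1 : ℝ) ≤ 2 * j + m := by exact_mod_cast h0
      linarith
  · intro m
    push_cast
    have h1 : (0 : ℝ) ≤ j := by positivity
    have h2 : (0 : ℝ) ≤ n := by positivity
    have h3 : (0 : ℝ) ≤ m := by positivity
    linarith

/-- expansion of the monomial `x^i` in the shifted Jacobi basis: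
`x^i = [(γ+1)_i/(β+γ+2)_i] Σ_{k=0}^{i} (-1)^k L^i (-i)_k (β+γ+2k+1)(β+γ+2)_{k-1} /
((1+γ)_k (β+γ+i+2)_k) · J_{L,k}^{β,γ}(x)`, where `(-i)_k = (-1)^k i!/(i-k)!`. -/
theorem monomial_shiftedJacobi_expansion (β γ L : ℝ) (hβ : -1 < β) (hγ : -1 < γ)
    (hbg : β + γ + 1 ≠ 0) (hL : 0 < L) (i : ℕ) (x : ℝ) :
    x ^ i = (poch (γ + 1) i / poch (β + γ + 2) i) *
      ∑ k ∈ Finset.range (i + 1),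
        ((-1 : ℝ) ^ k * L ^ i *
            ((-1 : ℝ) ^ k * (Nat.factorial i : ℝ) / (Nat.factorial (i - k) : ℝ)) *
            (β + γ + 2 * (k : ℝ) + 1) * poch (β + γ + 2) ((k : ℤ) - 1) /
          (poch (1 + γ) k * poch (β + γ + (i : ℝ) + 2) k)) * shiftedJacobi L β γ k x := by
  set s := β + γ + 1 with hs
  have hs1 : -1 < s := by linarith
  have hsk : ∀ k : ℕ, Real.Gamma ((k : ℝ) + s) ≠ 0 := by
    intro k
    refine Real.Gamma_ne_zero fun m h => ?_
    rcases Nat.eq_zero_or_pos (k + m) with h0 | h0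
    · have hk0 : k = 0 := by omega
      have hm0 : m = 0 := by omega
      subst hk0 hm0
      simp at h
      exact hbg h
    · have : (1 : ℝ) ≤ k + m := by exact_mod_cast h0
      linarith
  have hc : ∀ k : ℕ, Real.Gamma ((k : ℝ) + γ + 1) ≠ 0 := fun k =>
    (Real.Gamma_pos_of_pos (by have : (0 : ℝ) ≤ k := by positivity
                               linarith)).ne'
  have hc0 : Real.Gamma (γ + 1) ≠ 0 := (Real.Gamma_pos_of_pos (by linarith)).ne'
  have hs2 : ∀ k : ℕ, Real.Gamma (s + 1 + k) ≠ 0 := fun k =>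
    (Real.Gamma_pos_of_pos (by have : (0 : ℝ) ≤ k := by positivity
                               linarith)).ne'
  have hs3 : Real.Gamma (s + 1) ≠ 0 := (Real.Gamma_pos_of_pos (by linarith)).ne'
  have hs4 : ∀ k : ℕ, Real.Gamma (s + 1 + i + k) ≠ 0 := fun k => by
    have := hs2 (i + k)
    rwa [Nat.cast_add, ← add_assoc] at this
  have hL0 : L ≠ 0 := hL.ne'
  have term : ∀ k j : ℕ, (poch (γ + 1) i / poch (β + γ + 2) i) *
      (((-1 : ℝ) ^ k * L ^ i *
            ((-1 : ℝ) ^ k * (Nat.factorial i : ℝ) / (Nat.factorial (i - k) : ℝ)) *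
            (β + γ + 2 * (k : ℝ) + 1) * poch (β + γ + 2) ((k : ℤ) - 1) /
          (poch (1 + γ) k * poch (β + γ + (i : ℝ) + 2) k)) *
        ((-1 : ℝ) ^ (k - j) * Real.Gamma ((k : ℝ) + γ + 1) *
          Real.Gamma ((k : ℝ) + (j : ℝ) + β + γ + 1) /
      (Real.Gamma ((j : ℝ) + γ + 1) * Real.Gamma ((k : ℝ) + β + γ + 1) *
        (Nat.factorial (k - j) : ℝ) * (Nat.factorial j : ℝ) * L ^ j) * x ^ j)) =
      (Real.Gamma ((i : ℝ) + γ + 1) * (Nat.factorial i : ℝ) * L ^ i * x ^ j /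
        (Real.Gamma ((j : ℝ) + γ + 1) * (Nat.factorial j : ℝ) * L ^ j)) *
      ((-1 : ℝ) ^ (k - j) * (s + 2 * k) * Real.Gamma (k + j + s) /
        ((Nat.factorial (i - k) : ℝ) * (Nat.factorial (k - j) : ℝ) *
          Real.Gamma (s + 1 + i + k))) := by
    intro k j
    have hsq : (-1 : ℝ) ^ k * (-1 : ℝ) ^ k = 1 := by
      rw [← mul_pow]; norm_num
    have e1 : γ + 1 + ((i : ℤ) : ℝ) = i + γ + 1 := by push_cast; ring
    have e2 : β + γ + 2 + ((i : ℤ) : ℝ) = s + 1 + i := by rw [hs]; push_cast; ring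
    have e3 : β + γ + 2 = s + 1 := by rw [hs]; ring
    have e4 : β + γ + 2 + (((k : ℤ) - 1 : ℤ) : ℝ) = k + s := by rw [hs]; push_cast; ring
    have e5 : 1 + γ + ((k : ℤ) : ℝ) = k + γ + 1 := by push_cast; ring
    have e6 : β + γ + (i : ℝ) + 2 + ((k : ℤ) : ℝ) = s + 1 + i + k := by rw [hs]; push_cast; ring
    have e7 : β + γ + (i : ℝ) + 2 = s + 1 + i := by rw [hs]; ring
    have e8 : (k : ℝ) + j + β + γ + 1 = k + j + s := by rw [hs]; ring
    have e9 : (k : ℝ) + β + γ + 1 = k + s := by rw [hs]; ring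
    have e10 : β + γ + 2 * (k : ℝ) + 1 = s + 2 * k := by rw [hs]; ring
    simp only [poch]
    rw [e1, e2, e4, e5, e6, e7, e8, e9, e10, e3, add_comm 1 γ]
    have q1 := hsk k
    have q2 := hc k
    have q3 := hc j
    have q4 := hs2 i
    have q5 := hs4 k
    generalize Real.Gamma ((k : ℝ) + s) = A1 at *
    generalize Real.Gamma ((k : ℝ) + γ + 1) = A2 at *
    generalize Real.Gamma ((j : ℝ) + γ + 1) = A3 at *
    generalize Real.Gamma (s + 1 + i) = A4 at *
    generalize Real.Gamma (s + 1 + i + k) = A5 at *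
    generalize Real.Gamma (s + 1) = A6 at *
    generalize Real.Gamma (γ + 1) = A7 at *
    have f1 : (Nat.factorial (i - k) : ℝ) ≠ 0 := by positivity
    have f2 : (Nat.factorial (k - j) : ℝ) ≠ 0 := by positivity
    have f3 : (Nat.factorial j : ℝ) ≠ 0 := by positivity
    have r1 : (-1 : ℝ) ^ k * L ^ i *
        ((-1 : ℝ) ^ k * (Nat.factorial i : ℝ) / (Nat.factorial (i - k) : ℝ)) =
        L ^ i * ((Nat.factorial i : ℝ) / (Nat.factorial (i - k) : ℝ)) := by
      linear_combination (L ^ i * ((Nat.factorial i : ℝ) / (Nat.factorial (i - k) : ℝ))) * hsq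
    rw [r1]
    generalize (-1 : ℝ) ^ (k - j) = E at *
    field_simp
  simp only [shiftedJacobi, Finset.mul_sum, term]
  rw [Finset.sum_comm' (t' := Finset.range (i + 1)) (s' := fun j => Finset.Ico j (i + 1))
    (by intro a b; simp only [Finset.mem_range, Finset.mem_Ico]; omega)]
  simp only [← Finset.mul_sum]
  rw [Finset.sum_range_succ, Finset.sum_eq_zero, zero_add]
  · rw [Nat.Ico_succ_singleton, Finset.sum_singleton]
    have h2 : s + 2 * (i : ℝ) ≠ 0 := by
      rcases Nat.eq_zero_or_pos i with h0 | h0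
      · subst h0; simpa using hbg
      · have : (1 : ℝ) ≤ i := by exact_mod_cast h0
        intro h
        linarith
    have h3 : Real.Gamma (s + 1 + i + i) = (s + 2 * i) * Real.Gamma (i + i + s) := by
      have : (i : ℝ) + i + s = s + 2 * i := by ring
      rw [this, ← Real.Gamma_add_one h2]
      ring_nf
    have h4 := hs4 i
    have h5 : Real.Gamma (i + i + s) ≠ 0 := by
      intro h; rw [h3, h, mul_zero] at h4; exact h4 rfl
    have h6 := hc i
    have f3 : (Nat.factorial i : ℝ) ≠ 0 := by positivity
    rw [h3, Nat.sub_self, pow_zero, Nat.factorial_zero, Nat.cast_one]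
    generalize Real.Gamma ((i : ℝ) + i + s) = G at h5 ⊢
    generalize s + 2 * (i : ℝ) = T at h2 ⊢
    field_simp
  · intro j hj
    rw [sum_Ico_alternating_gamma s hs1 hbg i j (Finset.mem_range.1 hj), mul_zero]
end

section
/- Let β, γ > −1 with β + γ + 1 ≠ 0, let L > 0, and let i be a nonnegative integer. Then for every real x, (L−x)^i = [(β+1)_i / (β+γ+2)_i] · Σ_{k=0}^{i} [ L^i (−i)_k (β+γ+2k+1) (β+γ+2)_{k−1} / ((1+β)_k (β+γ+i+2)_k) ] · J_{L,k}^{β,γ}(x); equivalently, (x−L)^i equals (−1)^i times this right-hand side. -/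
open Real Finset

/-- Chu–Vandermonde summation, as the `N`-th finite difference of a quotient of Gamma functions. -/
theorem sum_choose_mul_Gamma_div_Gamma (N : ℕ) (b c : ℝ) (hb : ∀ m : ℕ, b + m ≠ 0) (hc : 0 < c) :
    ∑ m ∈ Finset.range (N + 1),
        (-1 : ℝ) ^ m * (N.choose m : ℝ) * (Real.Gamma (b + m) / Real.Gamma (c + m)) =
      Real.Gamma b * (∏ m ∈ Finset.range N, (c - b + m)) / Real.Gamma (c + N) := by
  induction N generalizing b c with
  | zero => simp
  | succ N ih =>
    have h1 := ih b c hb hc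
    have h2 := ih (b + 1) (c + 1)
      (fun m => by have := hb (m + 1); push_cast at this; rwa [add_assoc, add_comm (1 : ℝ)])
      (by linarith)
    have hsplit : ∑ m ∈ Finset.range (N + 1 + 1),
        (-1 : ℝ) ^ m * ((N + 1).choose m : ℝ) * (Real.Gamma (b + m) / Real.Gamma (c + m)) =
        (∑ m ∈ Finset.range (N + 1),
          (-1 : ℝ) ^ m * (N.choose m : ℝ) * (Real.Gamma (b + m) / Real.Gamma (c + m))) -
        ∑ m ∈ Finset.range (N + 1),
          (-1 : ℝ) ^ m * (N.choose m : ℝ) *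
            (Real.Gamma (b + 1 + m) / Real.Gamma (c + 1 + m)) := by
      have hext : ∑ m ∈ Finset.range (N + 1),
          (-1 : ℝ) ^ m * (N.choose m : ℝ) * (Real.Gamma (b + m) / Real.Gamma (c + m)) =
          ∑ m ∈ Finset.range (N + 1 + 1),
          (-1 : ℝ) ^ m * (N.choose m : ℝ) * (Real.Gamma (b + m) / Real.Gamma (c + m)) := by
        rw [Finset.sum_range_succ _ (N + 1)]
        simp
      rw [hext, Finset.sum_range_succ', Finset.sum_range_succ' _ (N + 1), add_sub_right_comm,
        ← Finset.sum_sub_distrib]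
      congr 1
      · refine Finset.sum_congr rfl fun m _ => ?_
        rw [Nat.choose_succ_succ]
        push_cast
        rw [show b + 1 + (m : ℝ) = b + (m + 1) by ring, show c + 1 + (m : ℝ) = c + (m + 1) by ring]
        ring
      · simp
    have hcN : 0 < c + N := by positivity
    have hG := (Real.Gamma_pos_of_pos hcN).ne'
    have hb0 : b ≠ 0 := by simpa using hb 0
    rw [hsplit, h1, h2, Real.Gamma_add_one hb0, Finset.prod_range_succ,
      show c + 1 + (N : ℝ) = c + N + 1 by ring, Real.Gamma_add_one hcN.ne']
    push_cast
    rw [show c + ((N : ℝ) + 1) = c + N + 1 by ring, Real.Gamma_add_one hcN.ne',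
      show c + 1 - (b + 1) = c - b by ring]
    field_simp
    ring

theorem prod_range_neg_add (N : ℕ) (d : ℝ) (hd : 0 < d) :
    ∏ m ∈ Finset.range N, (1 - d - N + m) =
      (-1 : ℝ) ^ N * (Real.Gamma (d + N) / Real.Gamma d) := by
  induction N with
  | zero => simp [(Real.Gamma_pos_of_pos hd).ne']
  | succ N ih =>
    have hdN : 0 < d + N := by positivity
    rw [Finset.prod_range_succ']
    push_cast
    rw [Finset.prod_congr rfl fun (m : ℕ) _ =>
      show 1 - d - ((N : ℝ) + 1) + (m + 1) = 1 - d - N + m by ring, ih,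
      ← add_assoc d, Real.Gamma_add_one hdN.ne']
    ring

theorem add_natCast_ne_zero_of_neg_one_lt {a : ℝ} (ha : -1 < a) (ha0 : a ≠ 0) (m : ℕ) :
    a + m ≠ 0 := by
  rcases m with _ | m
  · simpa
  · have : (0 : ℝ) ≤ m := m.cast_nonneg
    push_cast
    linarith

theorem Gamma_add_natCast_ne_zero {a : ℝ} (ha : ∀ m : ℕ, a + m ≠ 0) (m : ℕ) :
    Real.Gamma (a + m) ≠ 0 := by
  refine Real.Gamma_ne_zero fun p hp => ha (m + p) ?_
  push_cast
  linarith

/-- The shifted Jacobi polynomial expanded around the right endpoint `L`. -/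
theorem shiftedJacobi_eq_sum_right (L β γ : ℝ) (hL : 0 < L) (hβ : -1 < β) (hγ : -1 < γ)
    (hbg : β + γ + 1 ≠ 0) (k : ℕ) (x : ℝ) :
    shiftedJacobi L β γ k x = ∑ j ∈ Finset.range (k + 1),
      (-1 : ℝ) ^ j * (k.choose j : ℝ) / (k.factorial : ℝ) *
        (Real.Gamma (β + 1 + k) * Real.Gamma (β + γ + 1 + k + j) /
          (Real.Gamma (β + 1 + j) * Real.Gamma (β + γ + 1 + k))) * ((L - x) / L) ^ j := by
  have hterm : ∀ i ∈ Finset.range (k + 1),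
      (-1 : ℝ) ^ (k - i) * Real.Gamma ((k : ℝ) + γ + 1) *
        Real.Gamma ((k : ℝ) + (i : ℝ) + β + γ + 1) /
      (Real.Gamma ((i : ℝ) + γ + 1) * Real.Gamma ((k : ℝ) + β + γ + 1) *
        (Nat.factorial (k - i) : ℝ) * (Nat.factorial i : ℝ) * L ^ i) * x ^ i =
      ∑ j ∈ Finset.range (k + 1), (-1 : ℝ) ^ (k + i) * (k.choose i : ℝ) / (k.factorial : ℝ) *
        (Real.Gamma (γ + 1 + k) / Real.Gamma (β + γ + 1 + k)) *
        (Real.Gamma (β + γ + 1 + k + i) / Real.Gamma (γ + 1 + i)) *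
        ((-1 : ℝ) ^ j * (i.choose j : ℝ) * ((L - x) / L) ^ j) := by
    intro i hi
    have hik : i ≤ k := Nat.lt_succ_iff.mp (Finset.mem_range.mp hi)
    rw [← Finset.mul_sum]
    have hx : (x / L) ^ i =
        ∑ j ∈ Finset.range (k + 1), (-1 : ℝ) ^ j * (i.choose j : ℝ) * ((L - x) / L) ^ j := by
      have hsub : Finset.range (i + 1) ⊆ Finset.range (k + 1) :=
        Finset.range_subset_range.mpr (by omega)
      rw [← Finset.sum_subset hsub fun j _ hj => by
        rw [Nat.choose_eq_zero_of_lt (by simpa using hj)]; simp]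
      rw [show x / L = -((L - x) / L) + 1 by field_simp; ring, add_pow]
      refine Finset.sum_congr rfl fun j _ => ?_
      rw [neg_pow]
      ring
    rw [← hx, Nat.cast_choose ℝ hik]
    have hsign : (-1 : ℝ) ^ (k + i) = (-1 : ℝ) ^ (k - i) := by
      rw [show k + i = (k - i) + 2 * i by omega, pow_add, pow_mul]; simp
    have hk := Nat.cast_ne_zero (R := ℝ) |>.mpr k.factorial_ne_zero
    rw [hsign, show (k : ℝ) + γ + 1 = γ + 1 + k by ring,
      show (k : ℝ) + i + β + γ + 1 = β + γ + 1 + k + i by ring,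
      show (i : ℝ) + γ + 1 = γ + 1 + i by ring,
      show (k : ℝ) + β + γ + 1 = β + γ + 1 + k by ring, div_pow]
    field_simp
  rw [shiftedJacobi, Finset.sum_congr rfl hterm, Finset.sum_comm]
  refine Finset.sum_congr rfl fun j hj => ?_
  obtain ⟨N, rfl⟩ := Nat.exists_eq_add_of_le (Nat.lt_succ_iff.mp (Finset.mem_range.mp hj))
  have hne := add_natCast_ne_zero_of_neg_one_lt (a := β + γ + 1) (by linarith) hbg
  have hV := sum_choose_mul_Gamma_div_Gamma N (β + γ + 1 + ↑(j + N) + j) (γ + 1 + j)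
    (fun m => by have := hne (j + N + j + m); push_cast at this ⊢; ring_nf at this ⊢; exact this)
    (by have : (0 : ℝ) ≤ j := j.cast_nonneg
        linarith)
  have hd : 0 < β + 1 + (j : ℝ) := by
    have : (0 : ℝ) ≤ j := j.cast_nonneg
    linarith
  rw [Finset.prod_congr rfl fun (m : ℕ) _ =>
      show γ + 1 + (j : ℝ) - (β + γ + 1 + ↑(j + N) + j) + m = 1 - (β + 1 + j) - N + m by
        push_cast; ring,
    prod_range_neg_add N _ hd] at hV
  rw [add_assoc j N 1, Finset.sum_range_add, Finset.sum_eq_zero, zero_add]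
  swap
  · intro i hi
    rw [Nat.choose_eq_zero_of_lt (Finset.mem_range.mp hi)]
    simp
  trans (-1 : ℝ) ^ (j + N) * ((j + N).choose j : ℝ) / ((j + N).factorial : ℝ) *
      (Real.Gamma (γ + 1 + ↑(j + N)) / Real.Gamma (β + γ + 1 + ↑(j + N))) * ((L - x) / L) ^ j *
      ∑ m ∈ Finset.range (N + 1), (-1 : ℝ) ^ m * (N.choose m : ℝ) *
        (Real.Gamma (β + γ + 1 + ↑(j + N) + j + m) / Real.Gamma (γ + 1 + j + m))
  · rw [Finset.mul_sum]
    refine Finset.sum_congr rfl fun m _ => ?_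
    have hch : ((j + N).choose (j + m) : ℝ) * ((j + m).choose j : ℝ) =
        ((j + N).choose j : ℝ) * (N.choose m : ℝ) := by
      have := Nat.choose_mul (n := j + N) (k := j + m) (s := j) (by omega)
      simp only [Nat.add_sub_cancel_left] at this
      exact_mod_cast this
    have hsign : (-1 : ℝ) ^ (j + m) * (-1) ^ j = (-1) ^ m := by
      rw [pow_add, mul_right_comm, ← pow_add, ← two_mul, pow_mul]; simp
    rw [Nat.cast_add j m, ← add_assoc (β + γ + 1 + ((j + N : ℕ) : ℝ)), ← add_assoc (γ + 1),
      pow_add _ (j + N)]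
    linear_combination
      (-1 : ℝ) ^ (j + N) / ((j + N).factorial : ℝ) *
      (Real.Gamma (γ + 1 + ↑(j + N)) / Real.Gamma (β + γ + 1 + ↑(j + N))) * ((L - x) / L) ^ j *
        (Real.Gamma (β + γ + 1 + ↑(j + N) + j + m) / Real.Gamma (γ + 1 + j + m)) *
        (((-1 : ℝ) ^ (j + m) * (-1) ^ j) * hch +
          ((j + N).choose j : ℝ) * (N.choose m : ℝ) * hsign)
  · rw [hV, show γ + 1 + (j : ℝ) + N = γ + 1 + ↑(j + N) by push_cast; ring,
      show β + 1 + (j : ℝ) + N = β + 1 + ↑(j + N) by push_cast; ring]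
    have hγk : Real.Gamma (γ + 1 + ↑(j + N)) ≠ 0 := (Real.Gamma_pos_of_pos (by
      have : (0 : ℝ) ≤ ↑(j + N) := (j + N).cast_nonneg
      linarith)).ne'
    have hsign : (-1 : ℝ) ^ (j + N) * (-1) ^ N = (-1) ^ j := by
      rw [pow_add, mul_assoc, ← pow_add, ← two_mul, pow_mul]; simp
    rw [← hsign]
    field_simp

/-- Partial sums of the well-poised sum below, which telescopes. -/
theorem sum_range_choose_mul_wellPoised (N M : ℕ) (A : ℝ) (hA : ∀ m : ℕ, A + m ≠ 0) :
    ∑ m ∈ Finset.range (M + 1), (-1 : ℝ) ^ m * ((N + 1).choose m : ℝ) * (A + 2 * m) *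
        (Real.Gamma (A + m) / Real.Gamma (A + (N + 1) + m + 1)) =
      (-1 : ℝ) ^ M * (N.choose M : ℝ) *
        (Real.Gamma (A + M + 1) / Real.Gamma (A + (N + 1) + M + 1)) := by
  induction M with
  | zero =>
    have := hA 0
    simp only [Nat.cast_zero, add_zero] at this
    simp [Real.Gamma_add_one this]
    ring
  | succ M ih =>
    rw [Finset.sum_range_succ, ih]
    have h1 : A + M + 1 ≠ 0 := by simpa [add_assoc] using hA (M + 1)
    have h2 : A + (N + 1) + M + 1 ≠ 0 := by
      have := hA (N + M + 2)
      push_cast at this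
      ring_nf at this ⊢
      exact this
    have h3 : Real.Gamma (A + (N + 1) + M + 1) ≠ 0 := by
      have := Gamma_add_natCast_ne_zero hA (N + M + 2)
      push_cast at this
      ring_nf at this ⊢
      exact this
    have hP : ((N + 1).choose (M + 1) : ℝ) = N.choose M + N.choose (M + 1) := by
      exact_mod_cast Nat.choose_succ_succ N M
    have hQ : (N.choose (M + 1) : ℝ) * (M + 1) = N.choose M * (N - M) := by
      rcases le_or_gt M N with h | h
      · have := Nat.choose_succ_right_eq N M
        rw [← Nat.cast_sub h]
        exact_mod_cast this
      · simp [Nat.choose_eq_zero_of_lt h, Nat.choose_eq_zero_of_lt (h.trans (Nat.lt_succ_self M))]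
    push_cast
    rw [show A + ((M : ℝ) + 1) = A + M + 1 by ring,
      show A + ((N : ℝ) + 1) + (M + 1) + 1 = A + (N + 1) + M + 1 + 1 by ring,
      Real.Gamma_add_one h1, Real.Gamma_add_one h2, hP]
    field_simp
    rw [pow_succ]
    linear_combination -(-1 : ℝ) ^ M * Real.Gamma (A + M + 1) * hQ

/-- The coefficients of the two triangular basis changes are inverse to each other. -/
theorem sum_choose_mul_choose_wellPoised (a : ℝ) (ha : ∀ m : ℕ, a + m ≠ 0) (n j : ℕ)
    (hjn : j ≤ n) :
    ∑ k ∈ Finset.range (n + 1), (-1 : ℝ) ^ k * (n.choose k : ℝ) * (k.choose j : ℝ) *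
        (a + 2 * k) * (Real.Gamma (a + k + j) / Real.Gamma (a + n + 1 + k)) =
      if j = n then (-1 : ℝ) ^ n else 0 := by
  obtain ⟨N, rfl⟩ := Nat.exists_eq_add_of_le hjn
  have hA : ∀ m : ℕ, a + 2 * j + m ≠ 0 := fun m => by
    have := ha (2 * j + m)
    push_cast at this
    rwa [← add_assoc] at this
  rw [add_assoc j N 1, Finset.sum_range_add, Finset.sum_eq_zero, zero_add]
  swap
  · intro i hi
    rw [Nat.choose_eq_zero_of_lt (Finset.mem_range.mp hi)]
    simp
  trans (-1 : ℝ) ^ j * ((j + N).choose j : ℝ) *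
      ∑ m ∈ Finset.range (N + 1), (-1 : ℝ) ^ m * (N.choose m : ℝ) * (a + 2 * j + 2 * m) *
        (Real.Gamma (a + 2 * j + m) / Real.Gamma (a + 2 * j + N + m + 1))
  · rw [Finset.mul_sum]
    refine Finset.sum_congr rfl fun m _ => ?_
    have hch : ((j + N).choose (j + m) : ℝ) * ((j + m).choose j : ℝ) =
        ((j + N).choose j : ℝ) * (N.choose m : ℝ) := by
      have := Nat.choose_mul (n := j + N) (k := j + m) (s := j) (by omega)
      simp only [Nat.add_sub_cancel_left] at this
      exact_mod_cast this
    push_cast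
    rw [show a + ((j : ℝ) + m) + j = a + 2 * j + m by ring,
      show a + ((j : ℝ) + N) + 1 + (j + m) = a + 2 * j + N + m + 1 by ring]
    linear_combination (-1 : ℝ) ^ (j + m) * (a + 2 * (j + m)) *
      (Real.Gamma (a + 2 * j + m) / Real.Gamma (a + 2 * j + N + m + 1)) * hch
  · rcases N with _ | N
    · have h0 := hA 0
      have hG := Gamma_add_natCast_ne_zero hA 0
      simp only [Nat.cast_zero, add_zero] at h0 hG
      simp [Real.Gamma_add_one h0]
      field_simp
    · have := sum_range_choose_mul_wellPoised N (N + 1) (a + 2 * j) hA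
      rw [Nat.choose_succ_self] at this
      push_cast at this ⊢
      rw [this]
      simp

theorem sub_pow_eq_sum_shiftedJacobi (β γ L : ℝ) (hβ : -1 < β) (hγ : -1 < γ)
    (hbg : β + γ + 1 ≠ 0) (hL : 0 < L) (i : ℕ) (x : ℝ) :
    (L - x) ^ i = (poch (β + 1) i / poch (β + γ + 2) i) *
        ∑ k ∈ Finset.range (i + 1),
          (L ^ i * ((-1 : ℝ) ^ k * (Nat.factorial i : ℝ) / (Nat.factorial (i - k) : ℝ)) *
              (β + γ + 2 * (k : ℝ) + 1) * poch (β + γ + 2) ((k : ℤ) - 1) /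
            (poch (1 + β) k * poch (β + γ + (i : ℝ) + 2) k)) * shiftedJacobi L β γ k x := by
  have hne := add_natCast_ne_zero_of_neg_one_lt (a := β + γ + 1) (by linarith) hbg
  have hGne := Gamma_add_natCast_ne_zero hne
  have hGβ : ∀ m : ℕ, Real.Gamma (β + 1 + m) ≠ 0 := fun m => (Real.Gamma_pos_of_pos (by
    have : (0 : ℝ) ≤ m := m.cast_nonneg
    linarith)).ne'
  have hGβ0 : Real.Gamma (β + 1) ≠ 0 := by simpa using hGβ 0
  have hG1 : Real.Gamma (β + γ + 1 + 1) ≠ 0 := by simpa using hGne 1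
  have hGi : Real.Gamma (β + γ + 1 + i + 1) ≠ 0 := by simpa [add_assoc] using hGne (i + 1)
  have hterm : ∀ k ∈ Finset.range (i + 1),
      (L ^ i * ((-1 : ℝ) ^ k * (Nat.factorial i : ℝ) / (Nat.factorial (i - k) : ℝ)) *
              (β + γ + 2 * (k : ℝ) + 1) * poch (β + γ + 2) ((k : ℤ) - 1) /
            (poch (1 + β) k * poch (β + γ + (i : ℝ) + 2) k)) * shiftedJacobi L β γ k x =
      ∑ j ∈ Finset.range (i + 1), L ^ i * (Real.Gamma (β + 1) * Real.Gamma (β + γ + 1 + i + 1) /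
          Real.Gamma (β + γ + 1 + 1)) *
        ((-1 : ℝ) ^ j / Real.Gamma (β + 1 + j) * ((L - x) / L) ^ j) *
        ((-1 : ℝ) ^ k * (i.choose k : ℝ) * (k.choose j : ℝ) * (β + γ + 1 + 2 * k) *
          (Real.Gamma (β + γ + 1 + k + j) / Real.Gamma (β + γ + 1 + i + 1 + k))) := by
    intro k hk
    have hki : k ≤ i := Nat.lt_succ_iff.mp (Finset.mem_range.mp hk)
    have hsub : Finset.range (k + 1) ⊆ Finset.range (i + 1) :=
      Finset.range_subset_range.mpr (by omega)
    rw [shiftedJacobi_eq_sum_right L β γ hL hβ hγ hbg, Finset.mul_sum,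
      Finset.sum_subset hsub fun j _ hj => by
        rw [Nat.choose_eq_zero_of_lt (by simpa using hj)]; simp]
    refine Finset.sum_congr rfl fun j _ => ?_
    simp only [poch]
    push_cast
    rw [show β + γ + 2 + ((k : ℝ) - 1) = β + γ + 1 + k by ring,
      show β + γ + 2 = β + γ + 1 + 1 by ring, add_comm 1 β,
      show β + γ + (i : ℝ) + 2 = β + γ + 1 + i + 1 by ring, Nat.cast_choose ℝ hki,
      show β + γ + 2 * (k : ℝ) + 1 = β + γ + 1 + 2 * k by ring]
    have h1 := hGne k
    have h2 := hGβ k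
    have h3 := hGβ j
    have h4 : Real.Gamma (β + γ + 1 + i + 1 + k) ≠ 0 := by
      have := hGne (i + 1 + k)
      push_cast at this
      ring_nf at this ⊢
      exact this
    have hkf := Nat.cast_ne_zero (R := ℝ) |>.mpr k.factorial_ne_zero
    have hikf := Nat.cast_ne_zero (R := ℝ) |>.mpr (i - k).factorial_ne_zero
    field_simp
  rw [Finset.sum_congr rfl hterm, Finset.sum_comm]
  simp_rw [← Finset.mul_sum]
  rw [Finset.sum_congr rfl fun j hj => by
    rw [sum_choose_mul_choose_wellPoised (β + γ + 1) hne i j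
      (Nat.lt_succ_iff.mp (Finset.mem_range.mp hj))]]
  simp only [mul_ite, mul_zero, Finset.sum_ite_eq', Finset.mem_range, Nat.lt_succ_self, if_true,
    poch, Int.cast_natCast]
  rw [show β + γ + 2 + (i : ℝ) = β + γ + 1 + i + 1 by ring,
    show β + γ + 2 = β + γ + 1 + 1 by ring, div_pow]
  have h1 := hGβ i
  have hs : ((-1 : ℝ) ^ i) ^ 2 = 1 := by rw [← pow_mul, mul_comm, pow_mul]; simp
  field_simp
  rw [hs]
  ring

/-- expansion of `(L-x)^i` in the shifted Jacobi basis: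
`(L-x)^i = [(β+1)_i/(β+γ+2)_i] Σ_{k=0}^{i} L^i (-i)_k (β+γ+2k+1)(β+γ+2)_{k-1} /
((1+β)_k (β+γ+i+2)_k) · J_{L,k}^{β,γ}(x)`, where `(-i)_k = (-1)^k i!/(i-k)!`;
equivalently `(x-L)^i` equals `(-1)^i` times the same right-hand side. -/
theorem monomial_shiftedJacobi_expansion' (β γ L : ℝ) (hβ : -1 < β) (hγ : -1 < γ)
    (hbg : β + γ + 1 ≠ 0) (hL : 0 < L) (i : ℕ) (x : ℝ) :
    (L - x) ^ i = (poch (β + 1) i / poch (β + γ + 2) i) *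
        ∑ k ∈ Finset.range (i + 1),
          (L ^ i * ((-1 : ℝ) ^ k * (Nat.factorial i : ℝ) / (Nat.factorial (i - k) : ℝ)) *
              (β + γ + 2 * (k : ℝ) + 1) * poch (β + γ + 2) ((k : ℤ) - 1) /
            (poch (1 + β) k * poch (β + γ + (i : ℝ) + 2) k)) * shiftedJacobi L β γ k x
    ∧ (x - L) ^ i = (-1 : ℝ) ^ i * ((poch (β + 1) i / poch (β + γ + 2) i) *
        ∑ k ∈ Finset.range (i + 1),
          (L ^ i * ((-1 : ℝ) ^ k * (Nat.factorial i : ℝ) / (Nat.factorial (i - k) : ℝ)) *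
              (β + γ + 2 * (k : ℝ) + 1) * poch (β + γ + 2) ((k : ℤ) - 1) /
            (poch (1 + β) k * poch (β + γ + (i : ℝ) + 2) k)) * shiftedJacobi L β γ k x) := by
  have h := sub_pow_eq_sum_shiftedJacobi β γ L hβ hγ hbg hL i x
  refine ⟨h, ?_⟩
  rw [← h, ← mul_pow]
  ring
end

section
/- Let β, γ > −1, let L > 0, and let k, j be nonnegative integers. Then ∫₀^L J_{L,k}^{β,γ}(x) J_{L,j}^{β,γ}(x) x^γ (L−x)^β dx = 0 if k ≠ j, and ∫₀^L (J_{L,k}^{β,γ}(x))² x^γ (L−x)^β dx = L^{β+γ+1} Γ(k+β+1) Γ(k+γ+1) / [(2k+β+γ+1) k! Γ(k+β+γ+1)]. -/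
open Real Finset MeasureTheory

open Polynomial in
theorem ascPochhammer_natDegree_comp_X_add_C (n : ℕ) (c : ℝ) :
    ((ascPochhammer ℝ n).comp (X + C c)).natDegree = n := by
  rw [natDegree_comp, natDegree_X_add_C, mul_one, ascPochhammer_natDegree]

theorem Real.Gamma_add_natCast_eq_ascPochhammer_mul {z : ℝ} (hz : 0 < z) (n : ℕ) :
    Real.Gamma (z + n) = (ascPochhammer ℝ n).eval z * Real.Gamma z := by
  induction n with
  | zero => simp
  | succ n ih =>
    have h : z + n ≠ 0 := by positivity
    rw [Nat.cast_succ, ← add_assoc, Real.Gamma_add_one h, ih, ascPochhammer_succ_eval]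
    ring

theorem ascPochhammer_eval_neg_sub (k : ℕ) (b : ℝ) :
    (ascPochhammer ℝ k).eval (-(k + b)) = (-1) ^ k * (ascPochhammer ℝ k).eval (b + 1) := by
  rw [ascPochhammer_eval_neg_eq_descPochhammer, descPochhammer_eval_eq_ascPochhammer]
  congr 2
  ring

theorem sum_alternating_choose_mul_eq_fwdDiff_iter (f : ℝ → ℝ) (k : ℕ) (y : ℝ) :
    ∑ i ∈ range (k + 1), (-1 : ℝ) ^ (k - i) * (k.choose i : ℝ) * f (y + i) =
      (fwdDiff 1)^[k] f y := by
  rw [fwdDiff_iter_eq_sum_shift]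
  refine sum_congr rfl fun i _ => ?_
  simp [zsmul_eq_mul]

open Polynomial in
theorem sum_alternating_choose_mul_eval_eq_zero {p : ℝ[X]} {k : ℕ} (hp : p.natDegree < k) :
    ∑ i ∈ range (k + 1), (-1 : ℝ) ^ (k - i) * (k.choose i : ℝ) * p.eval (i : ℝ) = 0 := by
  have h := sum_alternating_choose_mul_eq_fwdDiff_iter (fun x => p.eval x) k 0
  rw [Polynomial.fwdDiff_iter_eq_zero_of_degree_lt hp] at h
  simpa using h

theorem fwdDiff_iter_inv (k : ℕ) {y : ℝ} (hy : ∀ m : ℕ, y ≠ -m) :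
    (fwdDiff 1)^[k] (fun x : ℝ => x⁻¹) y =
      (-1) ^ k * (k.factorial : ℝ) * Real.Gamma y / Real.Gamma (y + k + 1) := by
  induction k generalizing y with
  | zero =>
    have h0 : y ≠ 0 := by simpa using hy 0
    have hΓ : Real.Gamma y ≠ 0 := Real.Gamma_ne_zero hy
    simp only [Function.iterate_zero, id_eq, pow_zero, Nat.factorial_zero, Nat.cast_one,
      Nat.cast_zero, add_zero, Real.Gamma_add_one h0]
    field_simp
  | succ k ih =>
    have h0 : y ≠ 0 := by simpa using hy 0
    have hy' : ∀ m : ℕ, y + 1 ≠ -m := fun m h => hy (m + 1) (by push_cast; linarith)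
    have hk : y + k + 1 ≠ 0 := fun h => hy (k + 1) (by push_cast; linarith)
    have hΓ : Real.Gamma (y + k + 1) ≠ 0 :=
      Real.Gamma_ne_zero fun m h => hy (m + k + 1) (by push_cast; linarith)
    have hstep : Real.Gamma (y + 1 + k + 1) = (y + k + 1) * Real.Gamma (y + k + 1) := by
      rw [← Real.Gamma_add_one hk]
      ring_nf
    have hstep' : Real.Gamma (y + (k + 1 : ℕ) + 1) = (y + k + 1) * Real.Gamma (y + k + 1) := by
      rw [← hstep]
      push_cast
      ring_nf
    rw [Function.iterate_succ_apply', fwdDiff, ih hy', ih hy, hstep, hstep',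
      Real.Gamma_add_one h0, Nat.factorial_succ]
    push_cast
    field_simp
    ring

open Polynomial in
theorem sum_alternating_choose_mul_eval_div {p : ℝ[X]} {k : ℕ} (hp : p.natDegree ≤ k) {a : ℝ}
    (ha : ∀ m : ℕ, a ≠ -m) :
    ∑ i ∈ range (k + 1), (-1 : ℝ) ^ (k - i) * (k.choose i : ℝ) * (p.eval (i : ℝ) / (a + i)) =
      p.eval (-a) * ((-1) ^ k * (k.factorial : ℝ) * Real.Gamma a / Real.Gamma (a + k + 1)) := by
  set q := p /ₘ (X - C (-a)) with hq
  have hdiv : ∀ i : ℕ, p.eval (i : ℝ) / (a + i) = q.eval (i : ℝ) + p.eval (-a) * (a + i)⁻¹ := by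
    intro i
    have hai : a + i ≠ 0 := fun h => ha i (by linarith)
    have h := congrArg (Polynomial.eval (i : ℝ)) (modByMonic_add_div p (X - C (-a)))
    rw [modByMonic_X_sub_C_eq_C_eval] at h
    simp only [eval_add, eval_mul, eval_C, eval_sub, eval_X] at h
    rw [← h, ← hq]
    field_simp
    ring
  have hqsum : ∑ i ∈ range (k + 1), (-1 : ℝ) ^ (k - i) * (k.choose i : ℝ) * q.eval (i : ℝ) = 0 := by
    rcases Nat.eq_zero_or_pos k with rfl | hk
    · have hq0 : q = 0 := by
        rw [hq, divByMonic_eq_zero_iff (monic_X_sub_C _), degree_X_sub_C]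
        exact lt_of_le_of_lt degree_le_natDegree (by exact_mod_cast Nat.lt_one_iff.2 (by omega))
      simp [hq0]
    · refine sum_alternating_choose_mul_eval_eq_zero ?_
      rw [hq, natDegree_divByMonic _ (monic_X_sub_C _), natDegree_X_sub_C]
      omega
  rw [← fwdDiff_iter_inv k ha, ← sum_alternating_choose_mul_eq_fwdDiff_iter, mul_sum,
    ← zero_add (∑ i ∈ range (k + 1), p.eval (-a) * _), ← hqsum, ← sum_add_distrib]
  refine sum_congr rfl fun i _ => ?_
  rw [hdiv]
  ring

theorem integral_pow_mul_rpow_mul_sub_rpow {β γ L : ℝ} (hβ : -1 < β) (hγ : -1 < γ) (hL : 0 < L)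
    (n : ℕ) :
    ∫ x in (0 : ℝ)..L, x ^ n * (x ^ γ * (L - x) ^ β) =
      L ^ (n + (β + γ + 1)) *
        (Real.Gamma (n + γ + 1) * Real.Gamma (β + 1) / Real.Gamma (n + (β + γ + 1) + 1)) := by
  have hn : (0 : ℝ) ≤ n := n.cast_nonneg
  have h := Complex.betaIntegral_scaled ((n + γ + 1 : ℝ) : ℂ) ((β + 1 : ℝ) : ℂ) hL
  rw [Complex.betaIntegral_eq_Gamma_mul_div _ _ (by rw [Complex.ofReal_re]; linarith)
    (by rw [Complex.ofReal_re]; linarith), ← Complex.ofReal_add, Complex.Gamma_ofReal,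
    Complex.Gamma_ofReal, Complex.Gamma_ofReal] at h
  simp only [← Complex.ofReal_one, ← Complex.ofReal_sub, ← Complex.ofReal_mul,
    ← Complex.ofReal_div] at h
  rw [← Complex.ofReal_cpow hL.le, ← Complex.ofReal_mul] at h
  have hint : ∫ x in (0 : ℝ)..L, (x : ℂ) ^ ((n + γ + 1 - 1 : ℝ) : ℂ) *
      ((L - x : ℝ) : ℂ) ^ ((β + 1 - 1 : ℝ) : ℂ) =
      ∫ x in (0 : ℝ)..L, ((x ^ n * (x ^ γ * (L - x) ^ β) : ℝ) : ℂ) := by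
    simp_rw [intervalIntegral.integral_of_le hL.le]
    refine setIntegral_congr_fun measurableSet_Ioc fun x hx => ?_
    have hx0 : 0 < x := hx.1
    rw [← Complex.ofReal_cpow hx0.le, ← Complex.ofReal_cpow (sub_nonneg.2 hx.2),
      ← Complex.ofReal_mul, add_sub_cancel_right, add_sub_cancel_right, Real.rpow_add hx0,
      Real.rpow_natCast, mul_assoc]
  rw [hint, intervalIntegral.integral_ofReal] at h
  rw [Complex.ofReal_injective h]
  ring_nf

theorem intervalIntegrable_mul_rpow_mul_sub_rpow {β γ L : ℝ} (hβ : -1 < β) (hγ : -1 < γ)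
    (hL : 0 < L) {f : ℝ → ℝ} (hf : Continuous f) :
    IntervalIntegrable (fun x => f x * (x ^ γ * (L - x) ^ β)) volume 0 L := by
  refine IntervalIntegrable.continuousOn_mul ?_ hf.continuousOn
  by_contra hw
  have h := integral_pow_mul_rpow_mul_sub_rpow hβ hγ hL 0
  simp only [pow_zero, one_mul] at h
  have h1 : 0 < Real.Gamma ((0 : ℕ) + γ + 1) := Real.Gamma_pos_of_pos (by push_cast; linarith)
  have h2 : 0 < Real.Gamma (β + 1) := Real.Gamma_pos_of_pos (by linarith)
  have h3 : 0 < Real.Gamma ((0 : ℕ) + (β + γ + 1) + 1) :=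
    Real.Gamma_pos_of_pos (by push_cast; linarith)
  have h4 : 0 < L ^ ((0 : ℕ) + (β + γ + 1)) := Real.rpow_pos_of_pos hL _
  rw [show (∫ x in (0 : ℝ)..L, x ^ γ * (L - x) ^ β) = 0 from
    intervalIntegral.integral_undef hw] at h
  exact (mul_pos h4 (div_pos (mul_pos h1 h2) h3)).ne h

/-- The coefficient of `x ^ i` in `shiftedJacobi L β γ k x`. -/
noncomputable def shiftedJacobiCoeff (L β γ : ℝ) (k i : ℕ) : ℝ :=
  (-1 : ℝ) ^ (k - i) * Real.Gamma ((k : ℝ) + γ + 1) * Real.Gamma ((k : ℝ) + (i : ℝ) + β + γ + 1) /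
      (Real.Gamma ((i : ℝ) + γ + 1) * Real.Gamma ((k : ℝ) + β + γ + 1) *
        (Nat.factorial (k - i) : ℝ) * (Nat.factorial i : ℝ) * L ^ i)

theorem shiftedJacobi_eq_sum (L β γ : ℝ) (k : ℕ) (x : ℝ) :
    shiftedJacobi L β γ k x = ∑ i ∈ range (k + 1), shiftedJacobiCoeff L β γ k i * x ^ i :=
  rfl

theorem continuous_shiftedJacobi (L β γ : ℝ) (k : ℕ) : Continuous (shiftedJacobi L β γ k) := by
  unfold shiftedJacobi
  fun_prop

/-- Expansion of the moments of a shifted Jacobi polynomial as an alternating binomial sum. -/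
theorem integral_shiftedJacobi_mul_pow {β γ L : ℝ} (hβ : -1 < β) (hγ : -1 < γ) (hL : 0 < L)
    (k n : ℕ) :
    ∫ x in (0 : ℝ)..L, shiftedJacobi L β γ k x * x ^ n * (x ^ γ * (L - x) ^ β) =
      L ^ (n + (β + γ + 1)) * Real.Gamma (β + 1) * Real.Gamma (k + γ + 1) /
        (Real.Gamma (k + (β + γ + 1)) * (k.factorial : ℝ)) *
        ∑ i ∈ range (k + 1), (-1 : ℝ) ^ (k - i) * (k.choose i : ℝ) *
          ((ascPochhammer ℝ n).eval (i + (γ + 1)) *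
            (Real.Gamma (k + i + (β + γ + 1)) / Real.Gamma (n + i + (β + γ + 1) + 1))) := by
  have hsum : ∀ x : ℝ, shiftedJacobi L β γ k x * x ^ n * (x ^ γ * (L - x) ^ β) =
      ∑ i ∈ range (k + 1),
        shiftedJacobiCoeff L β γ k i * (x ^ (i + n) * (x ^ γ * (L - x) ^ β)) := by
    intro x
    rw [shiftedJacobi_eq_sum, sum_mul, sum_mul]
    exact sum_congr rfl fun i _ => by ring
  simp_rw [hsum]
  rw [intervalIntegral.integral_finsetSum fun i _ =>
    (intervalIntegrable_mul_rpow_mul_sub_rpow hβ hγ hL (continuous_pow (i + n))).const_mul _,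
    mul_sum]
  refine sum_congr rfl fun i hi => ?_
  have hik : i ≤ k := Nat.lt_succ_iff.1 (mem_range.1 hi)
  have hi0 : (0 : ℝ) ≤ i := i.cast_nonneg
  have hpos : 0 < (i : ℝ) + (γ + 1) := by linarith
  rw [intervalIntegral.integral_const_mul, integral_pow_mul_rpow_mul_sub_rpow hβ hγ hL,
    shiftedJacobiCoeff, Nat.cast_choose ℝ hik]
  have e1 : ((i + n : ℕ) : ℝ) + γ + 1 = i + (γ + 1) + n := by push_cast; ring
  have e2 : ((i + n : ℕ) : ℝ) + (β + γ + 1) = i + (n + (β + γ + 1)) := by push_cast; ring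
  have e3 : (n : ℝ) + i + (β + γ + 1) + 1 = i + (n + (β + γ + 1)) + 1 := by ring
  have e4 : (k : ℝ) + i + β + γ + 1 = k + i + (β + γ + 1) := by ring
  have e5 : (k : ℝ) + β + γ + 1 = k + (β + γ + 1) := by ring
  have e6 : (i : ℝ) + γ + 1 = i + (γ + 1) := by ring
  rw [e1, e2, e3, e4, e5, e6, Real.Gamma_add_natCast_eq_ascPochhammer_mul hpos, Real.rpow_add hL,
    Real.rpow_natCast]
  have hΓ : Real.Gamma (i + (γ + 1)) ≠ 0 := (Real.Gamma_pos_of_pos hpos).ne'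
  have hki : ((k - i).factorial : ℝ) ≠ 0 := by positivity
  have hk : (k.factorial : ℝ) ≠ 0 := by positivity
  field_simp

open Polynomial in
theorem integral_shiftedJacobi_mul_pow_of_lt {β γ L : ℝ} (hβ : -1 < β) (hγ : -1 < γ) (hL : 0 < L)
    {k n : ℕ} (hnk : n < k) :
    ∫ x in (0 : ℝ)..L, shiftedJacobi L β γ k x * x ^ n * (x ^ γ * (L - x) ^ β) = 0 := by
  rw [integral_shiftedJacobi_mul_pow hβ hγ hL]
  refine mul_eq_zero_of_right _ ?_
  obtain ⟨m, rfl⟩ := Nat.exists_eq_add_of_lt hnk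
  have hdeg : ((ascPochhammer ℝ n).comp (X + C (γ + 1)) *
      (ascPochhammer ℝ m).comp (X + C (n + (β + γ + 1) + 1))).natDegree < n + m + 1 := by
    refine natDegree_mul_le.trans_lt ?_
    rw [ascPochhammer_natDegree_comp_X_add_C, ascPochhammer_natDegree_comp_X_add_C]
    omega
  rw [← sum_alternating_choose_mul_eval_eq_zero hdeg]
  refine sum_congr rfl fun i _ => ?_
  have hpos : 0 < (i : ℝ) + (n + (β + γ + 1) + 1) := by
    have hi0 : (0 : ℝ) ≤ i := i.cast_nonneg
    have hn0 : (0 : ℝ) ≤ n := n.cast_nonneg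
    linarith
  have e1 : ((n + m + 1 : ℕ) : ℝ) + i + (β + γ + 1) = i + (n + (β + γ + 1) + 1) + m := by
    push_cast; ring
  have e2 : (n : ℝ) + i + (β + γ + 1) + 1 = i + (n + (β + γ + 1) + 1) := by ring
  rw [e1, e2, Real.Gamma_add_natCast_eq_ascPochhammer_mul hpos,
    mul_div_cancel_right₀ _ (Real.Gamma_pos_of_pos hpos).ne']
  simp only [eval_mul, eval_comp, eval_add, eval_X, eval_C]

open Polynomial in
theorem integral_shiftedJacobi_mul_pow_self {β γ L : ℝ} (hβ : -1 < β) (hγ : -1 < γ) (hL : 0 < L)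
    {k : ℕ} (hk : ∀ m : ℕ, k + (β + γ + 1) ≠ -m) :
    ∫ x in (0 : ℝ)..L, shiftedJacobi L β γ k x * x ^ k * (x ^ γ * (L - x) ^ β) =
      L ^ (k + (β + γ + 1)) * Real.Gamma (k + γ + 1) * Real.Gamma (k + β + 1) /
        Real.Gamma (k + (β + γ + 1) + k + 1) := by
  have hterm : ∀ i ∈ range (k + 1), (-1 : ℝ) ^ (k - i) * (k.choose i : ℝ) *
        ((ascPochhammer ℝ k).eval (i + (γ + 1)) *
          (Real.Gamma (k + i + (β + γ + 1)) / Real.Gamma (k + i + (β + γ + 1) + 1))) =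
      (-1 : ℝ) ^ (k - i) * (k.choose i : ℝ) *
        (((ascPochhammer ℝ k).comp (X + C (γ + 1))).eval (i : ℝ) / (k + (β + γ + 1) + i)) := by
    intro i _
    have e : (k : ℝ) + i + (β + γ + 1) = k + (β + γ + 1) + i := by ring
    have hne : (k : ℝ) + (β + γ + 1) + i ≠ 0 := fun h => hk i (by linarith)
    have hΓ : Real.Gamma (k + (β + γ + 1) + i) ≠ 0 :=
      Real.Gamma_ne_zero fun m h => hk (m + i) (by push_cast; linarith)
    rw [e, Real.Gamma_add_one hne]
    simp only [eval_comp, eval_add, eval_X, eval_C]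
    field_simp
  rw [integral_shiftedJacobi_mul_pow hβ hγ hL, sum_congr rfl hterm,
    sum_alternating_choose_mul_eval_div (ascPochhammer_natDegree_comp_X_add_C k _).le hk]
  have e1 : -((k : ℝ) + (β + γ + 1)) + (γ + 1) = -(k + β) := by ring
  have e2 : (k : ℝ) + β + 1 = β + 1 + k := by ring
  simp only [eval_comp, eval_add, eval_X, eval_C]
  rw [e1, e2, ascPochhammer_eval_neg_sub,
    Real.Gamma_add_natCast_eq_ascPochhammer_mul (by linarith : 0 < β + 1)]
  have hΓ : Real.Gamma (k + (β + γ + 1)) ≠ 0 := Real.Gamma_ne_zero hk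
  have hk0 : (k.factorial : ℝ) ≠ 0 := by positivity
  have hsign : ((-1 : ℝ) ^ k) * (-1) ^ k = 1 := by rw [← mul_pow]; norm_num
  field_simp
  linear_combination (Gamma (β + 1) * Gamma (k + γ + 1) * eval (β + 1) (ascPochhammer ℝ k) /
    Gamma (k + (β + γ + 1) + k + 1)) * hsign

theorem integral_shiftedJacobi_mul_shiftedJacobi {β γ L : ℝ} (hβ : -1 < β) (hγ : -1 < γ)
    (hL : 0 < L) (k j : ℕ) :
    ∫ x in (0 : ℝ)..L, shiftedJacobi L β γ k x * shiftedJacobi L β γ j x * x ^ γ * (L - x) ^ β =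
      ∑ i ∈ range (j + 1), shiftedJacobiCoeff L β γ j i *
        ∫ x in (0 : ℝ)..L, shiftedJacobi L β γ k x * x ^ i * (x ^ γ * (L - x) ^ β) := by
  simp_rw [← intervalIntegral.integral_const_mul]
  have hint : ∀ i : ℕ, IntervalIntegrable
      (fun x => shiftedJacobi L β γ k x * x ^ i * (x ^ γ * (L - x) ^ β)) volume 0 L := fun i =>
    intervalIntegrable_mul_rpow_mul_sub_rpow hβ hγ hL
      ((continuous_shiftedJacobi L β γ k).mul (continuous_pow i))
  rw [← intervalIntegral.integral_finsetSum fun i _ => (hint i).const_mul _]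
  congr 1
  funext x
  rw [shiftedJacobi_eq_sum L β γ j, mul_sum, sum_mul, sum_mul]
  exact sum_congr rfl fun i _ => by ring

theorem integral_shiftedJacobi_mul_shiftedJacobi_of_lt {β γ L : ℝ} (hβ : -1 < β) (hγ : -1 < γ)
    (hL : 0 < L) {k j : ℕ} (hjk : j < k) :
    ∫ x in (0 : ℝ)..L,
      shiftedJacobi L β γ k x * shiftedJacobi L β γ j x * x ^ γ * (L - x) ^ β = 0 := by
  rw [integral_shiftedJacobi_mul_shiftedJacobi hβ hγ hL]
  refine sum_eq_zero fun i hi => ?_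
  rw [integral_shiftedJacobi_mul_pow_of_lt hβ hγ hL (by have := mem_range.1 hi; omega), mul_zero]

theorem integral_shiftedJacobi_sq {β γ L : ℝ} (hβ : -1 < β) (hγ : -1 < γ) (hL : 0 < L) (k : ℕ) :
    (∫ x in (0 : ℝ)..L, (shiftedJacobi L β γ k x) ^ 2 * x ^ γ * (L - x) ^ β) =
      L ^ (β + γ + 1) * Real.Gamma ((k : ℝ) + β + 1) * Real.Gamma ((k : ℝ) + γ + 1) /
        ((2 * (k : ℝ) + β + γ + 1) * (Nat.factorial k : ℝ) *
          Real.Gamma ((k : ℝ) + β + γ + 1)) := by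
  have e1 : (k : ℝ) + β + γ + 1 = k + (β + γ + 1) := by ring
  by_cases hk : ∀ m : ℕ, k + (β + γ + 1) ≠ -m
  · simp_rw [sq]
    rw [integral_shiftedJacobi_mul_shiftedJacobi hβ hγ hL, sum_range_succ,
      sum_eq_zero fun i hi => by
        rw [integral_shiftedJacobi_mul_pow_of_lt hβ hγ hL (mem_range.1 hi), mul_zero],
      zero_add, integral_shiftedJacobi_mul_pow_self hβ hγ hL hk, shiftedJacobiCoeff]
    have e2 : (k : ℝ) + k + β + γ + 1 = k + (β + γ + 1) + k := by ring
    have e3 : 2 * (k : ℝ) + β + γ + 1 = k + (β + γ + 1) + k := by ring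
    have hne : (k : ℝ) + (β + γ + 1) + k ≠ 0 := fun h => hk k (by linarith)
    have hΓ : Real.Gamma (k + (β + γ + 1) + k) ≠ 0 :=
      Real.Gamma_ne_zero fun m h => hk (m + k) (by push_cast; linarith)
    have hΓ' : Real.Gamma (k + (β + γ + 1)) ≠ 0 := Real.Gamma_ne_zero hk
    have hΓγ : Real.Gamma (k + γ + 1) ≠ 0 :=
      (Real.Gamma_pos_of_pos (by have : (0 : ℝ) ≤ k := k.cast_nonneg; linarith)).ne'
    have hk0 : (k.factorial : ℝ) ≠ 0 := by positivity
    rw [e1, e2, e3, Real.Gamma_add_one hne, Real.rpow_add hL, Real.rpow_natCast]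
    simp only [Nat.sub_self, pow_zero, Nat.factorial_zero, Nat.cast_one, one_mul, mul_one]
    field_simp
  · -- At a pole both sides vanish, since `Real.Gamma` is zero there.
    push Not at hk
    obtain ⟨m, hm⟩ := hk
    have hΓ : Real.Gamma (k + (β + γ + 1)) = 0 := by rw [hm, Real.Gamma_neg_nat_eq_zero]
    simp [shiftedJacobi, e1, hΓ]

/-- Orthogonality of the shifted Jacobi polynomials on `[0,L]` with
respect to the weight `w_L^{β,γ}(x) = x^γ (L-x)^β`, together with the explicit value
of the normalization constant `h_k`. -/
theorem shiftedJacobi_orthogonality (β γ L : ℝ) (hβ : -1 < β) (hγ : -1 < γ) (hL : 0 < L)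
    (k j : ℕ) :
    (k ≠ j →
      ∫ x in (0:ℝ)..L,
          shiftedJacobi L β γ k x * shiftedJacobi L β γ j x * x ^ γ * (L - x) ^ β = 0)
    ∧ (∫ x in (0:ℝ)..L, (shiftedJacobi L β γ k x) ^ 2 * x ^ γ * (L - x) ^ β)
        = L ^ (β + γ + 1) * Real.Gamma ((k : ℝ) + β + 1) * Real.Gamma ((k : ℝ) + γ + 1) /
            ((2 * (k : ℝ) + β + γ + 1) * (Nat.factorial k : ℝ) *
              Real.Gamma ((k : ℝ) + β + γ + 1)) := by
  refine ⟨fun hkj => ?_, integral_shiftedJacobi_sq hβ hγ hL k⟩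
  rcases lt_or_gt_of_ne hkj with h | h
  · simp_rw [mul_comm (shiftedJacobi L β γ k _)]
    exact integral_shiftedJacobi_mul_shiftedJacobi_of_lt hβ hγ hL h
  · exact integral_shiftedJacobi_mul_shiftedJacobi_of_lt hβ hγ hL h
end

section
/- Let β, γ > −1, let L > 0, and let k be a nonnegative integer. Then the two analytic forms of the shifted Jacobi polynomial coincide: for every real x, Σ_{i=0}^{k} (−1)^{k−i} Γ(k+γ+1) Γ(k+i+β+γ+1) / [Γ(i+γ+1) Γ(k+β+γ+1) (k−i)! i! L^i] · x^i = Σ_{i=0}^{k} Γ(k+β+1) Γ(k+i+β+γ+1) / [Γ(i+β+1) Γ(k+β+γ+1) (k−i)! i! L^i] · (x−L)^i. -/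
open Real Finset

open Ring in
/-- The recurrence `(n + 1) * multichoose a (n + 1) = (a + n) * multichoose a n`. -/
theorem succ_mul_multichoose_succ (a : ℝ) (n : ℕ) :
    ((n : ℝ) + 1) * multichoose a (n + 1) = (a + n) * multichoose a n := by
  have h₀ := factorial_nsmul_multichoose_eq_ascPochhammer a n
  have h₁ := factorial_nsmul_multichoose_eq_ascPochhammer a (n + 1)
  rw [Polynomial.ascPochhammer_smeval_eq_eval, nsmul_eq_mul] at h₀ h₁
  rw [ascPochhammer_succ_eval, ← h₀, Nat.factorial_succ] at h₁
  push_cast at h₁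
  have hn : (n.factorial : ℝ) ≠ 0 := by positivity
  apply mul_left_cancel₀ hn
  linear_combination h₁

open Ring in
theorem Gamma_add_natCast_eq_mul_multichoose {a : ℝ} (ha : 0 < a) (n : ℕ) :
    Real.Gamma (a + n) = Real.Gamma a * (n.factorial * multichoose a n) := by
  induction n with
  | zero => simp
  | succ n ih =>
    have h := succ_mul_multichoose_succ a n
    rw [Nat.cast_succ, ← add_assoc, Real.Gamma_add_one (by positivity), ih, Nat.factorial_succ]
    push_cast
    linear_combination (-(n.factorial : ℝ) * Real.Gamma a) * h

open Ring in
theorem choose_neg_eq_neg_one_pow_mul_multichoose (a : ℝ) (n : ℕ) :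
    choose (-a) n = (-1) ^ n * multichoose a n := by
  rw [choose_neg', Int.negOnePow_def, Units.smul_def]
  simp

open Ring in
theorem multichoose_neg_eq_neg_one_pow_mul_multichoose (a : ℝ) (n : ℕ) :
    multichoose (-(a + n - 1)) n = (-1) ^ n * multichoose a n := by
  rw [multichoose_eq, ← choose_neg_eq_neg_one_pow_mul_multichoose]
  congr 1
  ring

open Ring in
/-- The Chu-Vandermonde identity for `Ring.multichoose`. -/
theorem multichoose_add_eq_sum (a b : ℝ) (n : ℕ) :
    multichoose (a + b) n =
      ∑ m ∈ Finset.range (n + 1), multichoose a m * multichoose b (n - m) := by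
  have h := add_choose_eq n (Commute.all (-a) (-b))
  rw [Finset.Nat.sum_antidiagonal_eq_sum_range_succ_mk, ← neg_add] at h
  simp only [choose_neg_eq_neg_one_pow_mul_multichoose] at h
  apply mul_left_cancel₀ (pow_ne_zero n (neg_ne_zero.mpr (one_ne_zero (α := ℝ))))
  rw [h, Finset.mul_sum]
  refine Finset.sum_congr rfl fun m hm => ?_
  have hmn : m + (n - m) = n := Nat.add_sub_cancel' (Finset.mem_range_succ_iff.mp hm)
  nth_rw 3 [← hmn]
  rw [pow_add]
  ring

open Ring in
theorem multichoose_add_mul_choose (s : ℝ) (j m : ℕ) :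
    multichoose s (j + m) * ((j + m).choose j : ℝ) = multichoose s j * multichoose (s + j) m := by
  induction m with
  | zero => simp
  | succ m ih =>
    have h₁ := succ_mul_multichoose_succ s (j + m)
    have h₂ := succ_mul_multichoose_succ (s + j) m
    have h₃ : ((j + m + 1).choose j : ℝ) * (m + 1) = (j + m).choose j * (j + m + 1) := by
      have := Nat.choose_mul_succ_eq (j + m) j
      rw [show j + m + 1 - j = m + 1 by lia] at this
      exact_mod_cast this.symm
    push_cast at h₁
    have hm : (m : ℝ) + 1 ≠ 0 := by positivity
    apply mul_left_cancel₀ hm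
    rw [← add_assoc]
    linear_combination multichoose s (j + m + 1) * h₃ + ((j + m).choose j : ℝ) * h₁
      - multichoose s j * h₂ + (s + j + m) * ih

open Ring in
/-- Re-expansion of a terminating hypergeometric-type sum around a shifted point. -/
theorem sum_multichoose_mul_add_one_pow (c s z : ℝ) (k : ℕ) :
    ∑ i ∈ Finset.range (k + 1), multichoose c (k - i) * multichoose s i * (z + 1) ^ i =
      ∑ j ∈ Finset.range (k + 1), multichoose (s + j + c) (k - j) * multichoose s j * z ^ j := by
  simp only [add_pow, one_pow, mul_one, Finset.mul_sum]
  rw [Finset.sum_comm' (t' := Finset.range (k + 1)) (s' := fun j => Finset.Ico j (k + 1))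
    (by simp only [Finset.mem_range, Finset.mem_Ico]; lia)]
  refine Finset.sum_congr rfl fun j hj => ?_
  have hjk : j ≤ k := Finset.mem_range_succ_iff.mp hj
  rw [Finset.sum_Ico_eq_sum_range, multichoose_add_eq_sum, Finset.sum_mul, Finset.sum_mul,
    show k + 1 - j = k - j + 1 by lia]
  refine Finset.sum_congr rfl fun m _ => ?_
  rw [Nat.sub_add_eq]
  linear_combination multichoose c (k - j - m) * z ^ j * multichoose_add_mul_choose s j m

open Ring in
theorem Gamma_mul_Gamma_div_eq_multichoose {a s : ℝ} (ha : -1 < a) (hs : 0 < s) {i k : ℕ}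
    (hik : i ≤ k) (L : ℝ) :
    Real.Gamma (k + a + 1) * Real.Gamma (s + i) /
        (Real.Gamma (i + a + 1) * Real.Gamma s * ((k - i).factorial : ℝ) * (i.factorial : ℝ) *
          L ^ i) =
      multichoose (i + a + 1) (k - i) * multichoose s i / L ^ i := by
  have hia : 0 < (i : ℝ) + a + 1 := by
    have : (0 : ℝ) ≤ i := by positivity
    linarith
  have hk : (k : ℝ) + a + 1 = i + a + 1 + (k - i : ℕ) := by
    rw [Nat.cast_sub hik]
    ring
  have h₁ := (Real.Gamma_pos_of_pos hia).ne'
  have h₂ := (Real.Gamma_pos_of_pos hs).ne'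
  rw [hk, Gamma_add_natCast_eq_mul_multichoose hia, Gamma_add_natCast_eq_mul_multichoose hs]
  have h₃ : ((k - i).factorial : ℝ) ≠ 0 := by positivity
  have h₄ : (i.factorial : ℝ) ≠ 0 := by positivity
  rw [← div_div]
  congr 1
  field_simp

/-- The two analytic forms of the shifted Jacobi polynomial coincide:
the expansion in powers of `x` equals the expansion in powers of `x - L`. -/
theorem shiftedJacobi_two_forms (β γ L : ℝ) (hβ : -1 < β) (hγ : -1 < γ) (hL : 0 < L)
    (k : ℕ) (x : ℝ) :
    (∑ i ∈ Finset.range (k + 1),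
      (-1 : ℝ) ^ (k - i) * Real.Gamma ((k : ℝ) + γ + 1) *
          Real.Gamma ((k : ℝ) + (i : ℝ) + β + γ + 1) /
        (Real.Gamma ((i : ℝ) + γ + 1) * Real.Gamma ((k : ℝ) + β + γ + 1) *
          (Nat.factorial (k - i) : ℝ) * (Nat.factorial i : ℝ) * L ^ i) * x ^ i)
    = ∑ i ∈ Finset.range (k + 1),
        Real.Gamma ((k : ℝ) + β + 1) * Real.Gamma ((k : ℝ) + (i : ℝ) + β + γ + 1) /
          (Real.Gamma ((i : ℝ) + β + 1) * Real.Gamma ((k : ℝ) + β + γ + 1) *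
            (Nat.factorial (k - i) : ℝ) * (Nat.factorial i : ℝ) * L ^ i) * (x - L) ^ i := by
  rcases Nat.eq_zero_or_pos k with rfl | hk
  · have h₁ : Real.Gamma (γ + 1) ≠ 0 := (Real.Gamma_pos_of_pos (by linarith)).ne'
    have h₂ : Real.Gamma (β + 1) ≠ 0 := (Real.Gamma_pos_of_pos (by linarith)).ne'
    simp [mul_div_mul_left, h₁, h₂]
  have hk' : (1 : ℝ) ≤ k := by exact_mod_cast hk
  have hs : 0 < (k : ℝ) + β + γ + 1 := by linarith
  have hx : x / L = (x - L) / L + 1 := by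
    field_simp
    ring
  have key := sum_multichoose_mul_add_one_pow (-(k + γ)) (k + β + γ + 1) ((x - L) / L) k
  rw [← hx] at key
  have hsi (i : ℕ) : (k : ℝ) + i + β + γ + 1 = k + β + γ + 1 + i := by ring
  simp only [hsi]
  convert key using 1
  · refine Finset.sum_congr rfl fun i hi => ?_
    have hik : i ≤ k := Finset.mem_range_succ_iff.mp hi
    have h := multichoose_neg_eq_neg_one_pow_mul_multichoose (i + γ + 1) (k - i)
    rw [Nat.cast_sub hik, show (i : ℝ) + γ + 1 + (k - i) - 1 = k + γ by ring] at h
    rw [h, mul_assoc, mul_div_assoc, Gamma_mul_Gamma_div_eq_multichoose hγ hs hik, div_pow]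
    ring
  · refine Finset.sum_congr rfl fun i hi => ?_
    have hik : i ≤ k := Finset.mem_range_succ_iff.mp hi
    rw [Gamma_mul_Gamma_div_eq_multichoose hβ hs hik, div_pow,
      show (k : ℝ) + β + γ + 1 + i + -(k + γ) = i + β + 1 by ring]
    ring
end
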